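/- arXiv:1905.12825 — 3 statements merged into one kernel-verified Lean document; each statement's English description precedes it below -/
import Mathlib

section
/- Consider the multiple isotonic regression model with f₀ and x₀ satisfying Assumption A1 with parameters s and α = (α_1,…,α_d), design points following the β-fixed lattice design, and errors ξ_i i.i.d. N(0,σ²) with σ > 0. Let κ_* and n_* be as defined for the fixed lattice design. Then there exists a constant L > 0, depending only on d, max_{1≤k≤s} α_k and f₀, such that sup_{τ>0} liminf_{n→∞} inf_T sup_f E_f[ (n_*/σ²)^{1/(2 + Σ_{k=κ_*}^s α_k^{−1})} · |T(Y_1,…,Y_n) − f(x₀)| ] ≥ L, where the inner supremum is over all f ∈ F_d with n^{−1}·Σ_{i=1}^n (f(X_i) − f₀(X_i))² ≤ τσ²/n, the infimum is over all estimators T, and E_f denotes expectation under Y_i = f(X_i) + ξ_i. -/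
open MeasureTheory Filter

/-- Iterated partial derivative in the `k`-th coordinate (one step). -/
noncomputable def pderiv (d : ℕ) (k : Fin d) (f : (Fin d → ℝ) → ℝ) : (Fin d → ℝ) → ℝ :=
  fun x => fderiv ℝ f x (Pi.single k 1)

/-- `j`-fold iterated partial derivative in the `k`-th coordinate. -/
noncomputable def pderivIter (d : ℕ) (k : Fin d) (j : ℕ) (f : (Fin d → ℝ) → ℝ) :
    (Fin d → ℝ) → ℝ :=
  (pderiv d k)^[j] f

/-- Mixed partial derivative `∂^𝐣 = ∂_1^{j_1} ⋯ ∂_d^{j_d}`. -/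
noncomputable def mixedPDeriv (d : ℕ) (j : Fin d → ℕ) (f : (Fin d → ℝ) → ℝ) :
    (Fin d → ℝ) → ℝ :=
  (List.finRange d).foldr (fun k g => pderivIter d k (j k) g) f

/-- The anisotropic Taylor polynomial of `f` at `x₀` over the multi-index set
`J₀ = {𝐣 : j_k = 0 for k > s, Σ_{k≤s} j_k/α_k ≤ 1}`. -/
noncomputable def taylorJ0 (d s : ℕ) (α : Fin d → ℕ) (f : (Fin d → ℝ) → ℝ)
    (x₀ x : Fin d → ℝ) : ℝ :=
  ∑ j : (∀ k : Fin d, Fin (α k + 1)),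
    if (∀ k : Fin d, s ≤ (k : ℕ) → (j k : ℕ) = 0) ∧
        (∑ k : Fin d, if (k : ℕ) < s then ((j k : ℕ) : ℝ) / (α k : ℝ) else 0) ≤ 1 then
      (mixedPDeriv d (fun k => (j k : ℕ)) f x₀ /
          ∏ k : Fin d, (Nat.factorial (j k : ℕ) : ℝ)) *
        ∏ k : Fin d, (x k - x₀ k) ^ ((j k : ℕ))
    else 0

/-- Anisotropic localization rates: `(r_n)_k = ω^{1/α_k}` for `k ≤ s` and `1` otherwise. -/
noncomputable def rVec (d s : ℕ) (α : Fin d → ℕ) (ωn : ℝ) : Fin d → ℝ :=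
  fun k => if (k : ℕ) < s then ωn ^ ((α k : ℝ)⁻¹) else 1

/-- Assumption A1: local anisotropic smoothness of the isotonic function `f₀` at `x₀`
with intrinsic dimension `s` and smoothness indices `α`. -/
def AssumptionA1 (d s : ℕ) (α : Fin d → ℕ) (f₀ : (Fin d → ℝ) → ℝ)
    (x₀ : Fin d → ℝ) : Prop :=
  s ≤ d ∧
  (∀ k : Fin d, x₀ k ∈ Set.Ioo (0 : ℝ) 1) ∧
  MonotoneOn f₀ (Set.Icc (0 : Fin d → ℝ) 1) ∧
  (∀ k : Fin d, (k : ℕ) < s → 1 ≤ α k) ∧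
  (∃ U : Set (Fin d → ℝ), IsOpen U ∧ x₀ ∈ U ∧
    ContDiffOn ℝ (((Finset.univ.filter (fun k : Fin d => (k : ℕ) < s)).sup α : ℕ)) f₀ U) ∧
  (∀ k : Fin d, (k : ℕ) < s →
    (∀ j : ℕ, 1 ≤ j → j ≤ α k - 1 → pderivIter d k j f₀ x₀ = 0) ∧
      pderivIter d k (α k) f₀ x₀ ≠ 0) ∧
  (∀ L₀ : ℝ, 0 < L₀ → ∀ ω : ℕ → ℝ, (∀ n, 0 < ω n) → Antitone ω →
    Tendsto ω atTop (nhds 0) →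
    Tendsto (fun n =>
      (ω n)⁻¹ * sSup {y : ℝ | ∃ x : Fin d → ℝ, x ∈ Set.Icc (0 : Fin d → ℝ) 1 ∧
        (∀ k : Fin d, |x k - x₀ k| ≤ L₀ * rVec d s α (ω n) k) ∧
        y = |f₀ x - taylorJ0 d s α f₀ x₀ x|}) atTop (nhds 0))

/-- Number of lattice points along dimension `k` at stage `n`: `⌊n^{β_k}⌋`. -/
noncomputable def latticeDim (d : ℕ) (β : Fin d → ℝ) (n : ℕ) (k : Fin d) : ℕ :=
  Nat.floor ((n : ℝ) ^ (β k))

/-- The lattice design point indexed by `v`, with per-dimension starting points `a n`. -/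
noncomputable def latticePt (d : ℕ) (β : Fin d → ℝ) (a : ℕ → Fin d → ℝ) (n : ℕ)
    (v : ∀ k : Fin d, Fin (latticeDim d β n k)) : Fin d → ℝ :=
  fun k => a n k + (v k : ℝ) / (latticeDim d β n k : ℝ)

/-- Average of the observations `Y` over the design points lying in the block `[xu, xv]`
(zero if the block contains no design point). -/
noncomputable def blockAvg {d : ℕ} {ι : Type*} [Fintype ι] (X : ι → (Fin d → ℝ))
    (Y : ι → ℝ) (xu xv : Fin d → ℝ) : ℝ :=
  haveI := Classical.decPred fun i => X i ∈ Set.Icc xu xv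
  (∑ i ∈ Finset.univ.filter (fun i => X i ∈ Set.Icc xu xv), Y i) /
    ((Finset.univ.filter (fun i => X i ∈ Set.Icc xu xv)).card : ℝ)

/-- The max–min block estimator at `x₀`. -/
noncomputable def maxMinEst {d : ℕ} {ι : Type*} [Fintype ι] (X : ι → (Fin d → ℝ))
    (Y : ι → ℝ) (x₀ : Fin d → ℝ) : ℝ :=
  sSup {z : ℝ | ∃ xu : Fin d → ℝ, xu ≤ x₀ ∧
    z = sInf {w : ℝ | ∃ xv : Fin d → ℝ, x₀ ≤ xv ∧ (∃ i : ι, X i ∈ Set.Icc xu xv) ∧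
      w = blockAvg X Y xu xv}}

lemma aux_pi_mono {ι : Type*} [Fintype ι] (μ ν : ι → Measure ℝ) (h : ∀ i, μ i ≤ ν i) :
    Measure.pi μ ≤ Measure.pi ν := by
  rw [Measure.le_iff]
  intro s hs
  rw [Measure.pi_def, Measure.pi_def, toMeasure_apply _ _ hs, toMeasure_apply _ _ hs]
  have : OuterMeasure.pi (fun i => (μ i).toOuterMeasure)
      ≤ OuterMeasure.pi (fun i => (ν i).toOuterMeasure) := by
    rw [OuterMeasure.le_pi]
    intro t _
    refine (OuterMeasure.pi_pi_le _ t).trans ?_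
    exact Finset.prod_le_prod' fun i _ => h i (t i)
  exact this s

lemma aux_gauss (σ : ℝ) (hσ : 0 < σ) (m m0 : ℝ) (h1 : m0 ≤ m) (h2 : m ≤ m0 + σ) :
    ENNReal.ofReal ((√(2 * Real.pi * σ ^ 2))⁻¹ * Real.exp (-1 / 2)) •
      (volume.restrict (Set.Icc m0 (m0 + σ))) ≤
      ProbabilityTheory.gaussianReal m ((σ ^ 2).toNNReal) := by
  have hv : (σ ^ 2).toNNReal ≠ 0 := by
    simp; positivity
  rw [ProbabilityTheory.gaussianReal_of_var_ne_zero _ hv, ← withDensity_const,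
    ← withDensity_indicator measurableSet_Icc]
  refine withDensity_mono (Eventually.of_forall fun x => ?_)
  by_cases hx : x ∈ Set.Icc m0 (m0 + σ)
  · rw [Set.indicator_of_mem hx, ProbabilityTheory.gaussianPDF]
    refine ENNReal.ofReal_le_ofReal ?_
    rw [ProbabilityTheory.gaussianPDFReal_def]
    have : ((σ ^ 2).toNNReal : ℝ) = σ ^ 2 := Real.coe_toNNReal _ (by positivity)
    simp only [this]
    refine mul_le_mul_of_nonneg_left ?_ (by positivity)
    rw [Real.exp_le_exp, div_le_div_iff₀ (by norm_num) (by positivity)]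
    have : (x - m) ^ 2 ≤ σ ^ 2 := by
      apply sq_le_sq'
      · linarith [hx.1]
      · linarith [hx.2]
    linarith
  · rw [Set.indicator_of_notMem hx]; exact bot_le

lemma aux_twopoint {ι : Type*} [Fintype ι] (i0 : ι) (σ : ℝ) (hσ : 0 < σ) (m1 m2 : ι → ℝ)
    (h : ∀ i, i ≠ i0 → m1 i = m2 i) (h1 : m2 i0 ≤ m1 i0) (h2 : m1 i0 ≤ m2 i0 + σ) :
    ∃ Q : Measure (ι → ℝ),
      Q Set.univ = ENNReal.ofReal ((√(2 * Real.pi))⁻¹ * Real.exp (-1 / 2)) ∧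
      Q ≤ Measure.pi (fun i => ProbabilityTheory.gaussianReal (m1 i) ((σ ^ 2).toNNReal)) ∧
      Q ≤ Measure.pi (fun i => ProbabilityTheory.gaussianReal (m2 i) ((σ ^ 2).toNNReal)) := by
  classical
  set u : Measure ℝ := ENNReal.ofReal ((√(2 * Real.pi * σ ^ 2))⁻¹ * Real.exp (-1 / 2)) •
      (volume.restrict (Set.Icc (m2 i0) (m2 i0 + σ))) with hu
  have hfin : IsFiniteMeasure u := by
    rw [hu]
    exact Measure.smul_finite _ ENNReal.ofReal_ne_top
  let q : ι → Measure ℝ := fun i => if i = i0 then u else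
    ProbabilityTheory.gaussianReal (m1 i) ((σ ^ 2).toNNReal)
  have hq : ∀ i, IsFiniteMeasure (q i) := by
    intro i
    simp only [q]
    split_ifs <;> infer_instance
  refine ⟨Measure.pi q, ?_, ?_, ?_⟩
  · rw [Measure.pi_univ, Finset.prod_eq_single i0]
    · simp only [q, if_true, hu, Measure.smul_apply, Measure.restrict_apply_univ, Real.volume_Icc,
        smul_eq_mul]
      rw [← ENNReal.ofReal_mul (by positivity)]
      congr 1
      rw [Real.sqrt_mul (by positivity), Real.sqrt_sq hσ.le]
      field_simp
      ring
    · intro i _ hi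
      simp [q, hi]
    · simp
  · refine aux_pi_mono _ _ fun i => ?_
    by_cases hi : i = i0
    · subst hi; simp only [q, if_true]; exact aux_gauss σ hσ _ _ h1 h2
    · simp [q, hi]
  · refine aux_pi_mono _ _ fun i => ?_
    by_cases hi : i = i0
    · subst hi; simp only [q, if_true]; exact aux_gauss σ hσ _ _ le_rfl (by linarith)
    · simp [q, hi, h i hi]

lemma aux_taylor (η C : ℝ) (m : ℕ) : ∀ h : ℕ → ℝ → ℝ,
    (∀ j, j ≤ m → ∀ t ∈ Set.Icc 0 η, HasDerivAt (h j) (h (j + 1) t) t) →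
    (∀ t ∈ Set.Icc 0 η, C ≤ h (m + 1) t) → (∀ j, 1 ≤ j → j ≤ m → h j 0 = 0) →
    ∀ t ∈ Set.Icc 0 η, h 0 0 + C * t ^ (m + 1) / (m + 1).factorial ≤ h 0 t := by
  induction m with
  | zero =>
    intro h hd hC _ t ht
    have := (convex_Icc (0:ℝ) η).mul_sub_le_image_sub_of_le_deriv (f := h 0)
      (fun x hx => (hd 0 le_rfl x hx).continuousAt.continuousWithinAt)
      (fun x hx => (hd 0 le_rfl x (interior_subset hx)).differentiableAt.differentiableWithinAt)
      (C := C) (fun x hx => by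
        rw [(hd 0 le_rfl x (interior_subset hx)).deriv]; exact hC x (interior_subset hx))
      0 ⟨le_rfl, ht.1.trans ht.2⟩ t ht ht.1
    simp at this ⊢
    linarith
  | succ m ih =>
    intro h hd hC h0 t ht
    have key := ih (fun j => h (j + 1)) (fun j hj => hd (j + 1) (by omega)) hC
      (fun j h1 h2 => h0 (j + 1) (by omega) (by omega))
    have h10 : h 1 0 = 0 := h0 1 le_rfl (by omega)
    simp only [zero_add, h10] at key
    have hder : ∀ x ∈ Set.Icc 0 η, HasDerivAt
        (fun t => h 0 t - C * t ^ (m + 1 + 1) / (m + 1 + 1).factorial)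
        (h 1 x - C * x ^ (m + 1) / (m + 1).factorial) x := by
      intro x hx
      refine (hd 0 (by omega) x hx).sub ?_
      have := ((hasDerivAt_pow (m + 1 + 1) x).const_mul C).div_const ((m + 1 + 1).factorial : ℝ)
      refine this.congr_deriv ?_
      rw [Nat.factorial_succ (m + 1)]
      push_cast
      have : ((m + 1).factorial : ℝ) ≠ 0 := by positivity
      have : (m : ℝ) + 1 + 1 ≠ 0 := by positivity
      field_simp
    have := (convex_Icc (0:ℝ) η).mul_sub_le_image_sub_of_le_deriv
      (fun x hx => (hder x hx).continuousAt.continuousWithinAt)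
      (fun x hx => (hder x (interior_subset hx)).differentiableAt.differentiableWithinAt)
      (C := 0) (fun x hx => by
        rw [(hder x (interior_subset hx)).deriv]; linarith [key x (interior_subset hx)])
      0 ⟨le_rfl, ht.1.trans ht.2⟩ t ht ht.1
    simp at this ⊢
    linarith

lemma aux_smooth (d : ℕ) (k : Fin d) (f : (Fin d → ℝ) → ℝ) (U : Set (Fin d → ℝ)) (hU : IsOpen U)
    (j : ℕ) : ∀ N : ℕ, ContDiffOn ℝ ((N + j : ℕ)) f U → ContDiffOn ℝ N (pderivIter d k j f) U := by
  induction j with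
  | zero => intro N h; simpa [pderivIter] using h
  | succ j ih =>
    intro N h
    have h1 := ih (N + 1) (by rwa [show N + 1 + j = N + (j + 1) by ring])
    rw [pderivIter, Function.iterate_succ_apply']
    unfold pderiv
    exact (h1.fderiv_of_isOpen hU (m := N) (by norm_cast)).clm_apply contDiffOn_const

lemma aux_line (d : ℕ) (k : Fin d) (m : ℕ) (f : (Fin d → ℝ) → ℝ) (x₀ : Fin d → ℝ)
    (U : Set (Fin d → ℝ)) (hU : IsOpen U) (hx : x₀ ∈ U) (hf : ContDiffOn ℝ ((m + 1 : ℕ)) f U)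
    (h0 : ∀ j, 1 ≤ j → j ≤ m → pderivIter d k j f x₀ = 0)
    (h1 : 0 < pderivIter d k (m + 1) f x₀) :
    ∃ C η : ℝ, 0 < C ∧ 0 < η ∧ ∀ t ∈ Set.Icc 0 η,
      f x₀ + C * t ^ (m + 1) ≤ f (x₀ + t • Pi.single k 1) := by
  set ℓ : ℝ → (Fin d → ℝ) := fun t => x₀ + t • Pi.single k 1 with hℓ
  have hℓd : ∀ t, HasDerivAt ℓ (Pi.single k 1) t := by
    intro t
    have := ((hasDerivAt_id t).smul_const (Pi.single k (1:ℝ) : Fin d → ℝ)).const_add x₀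
    rw [one_smul] at this
    exact this
  have hℓ0 : ℓ 0 = x₀ := by simp [hℓ]
  have hcont : ContinuousAt ℓ 0 := (hℓd 0).continuousAt
  have e1 : ∀ᶠ t in nhds (0:ℝ), ℓ t ∈ U :=
    hcont.eventually (by rw [hℓ0]; exact hU.mem_nhds hx)
  have hc := (aux_smooth d k f U hU (m + 1) 0 (by simpa using hf)).continuousOn
  have e2 : ∀ᶠ t in nhds (0:ℝ), pderivIter d k (m + 1) f x₀ / 2 < pderivIter d k (m + 1) f (ℓ t) := by
    have : ContinuousAt (pderivIter d k (m + 1) f ∘ ℓ) 0 := by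
      refine ContinuousAt.comp ?_ hcont
      rw [hℓ0]
      exact hc.continuousAt (hU.mem_nhds hx)
    refine this.eventually (lt_mem_nhds ?_)
    simp only [Function.comp, hℓ0]
    linarith
  obtain ⟨η, hη, H⟩ := Metric.eventually_nhds_iff.1 (e1.and e2)
  have H' : ∀ t ∈ Set.Icc 0 (η / 2), ℓ t ∈ U ∧
      pderivIter d k (m + 1) f x₀ / 2 < pderivIter d k (m + 1) f (ℓ t) := by
    intro t ht
    apply H
    rw [Real.dist_eq, sub_zero, abs_of_nonneg ht.1]
    linarith [ht.2]
  have T := aux_taylor (η / 2) (pderivIter d k (m + 1) f x₀ / 2) m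
    (fun j t => pderivIter d k j f (ℓ t)) ?_ (fun t ht => (H' t ht).2.le) ?_
  · refine ⟨pderivIter d k (m + 1) f x₀ / 2 / (m + 1).factorial, η / 2, by positivity, by positivity, ?_⟩
    intro t ht
    have := T t ht
    simp only [hℓ0, pderivIter, Function.iterate_zero, id] at this
    refine le_trans (le_of_eq ?_) this
    simp only [pderivIter]
    ring
  · intro j hj t ht
    have hs : ContDiffOn ℝ ((m + 1 - j : ℕ)) (pderivIter d k j f) U :=
      aux_smooth d k f U hU j (m + 1 - j) (by rwa [show m + 1 - j + j = m + 1 by omega])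
    have hdiff : DifferentiableAt ℝ (pderivIter d k j f) (ℓ t) :=
      (hs.differentiableOn (by norm_cast; omega)).differentiableAt (hU.mem_nhds (H' t ht).1)
    have := hdiff.hasFDerivAt.comp_hasDerivAt t (hℓd t)
    refine this.congr_deriv ?_
    simp only [pderivIter, Function.iterate_succ_apply', pderiv]
  · intro j a b
    simp only [hℓ0]
    exact h0 j a b

lemma aux_neg (d : ℕ) (k : Fin d) (f : (Fin d → ℝ) → ℝ) (j : ℕ) (x : Fin d → ℝ) :
    pderivIter d k j (fun x => - f x) x = - pderivIter d k j f x := by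
  have : pderivIter d k j (fun x => - f x) = fun x => - pderivIter d k j f x := by
    induction j with
    | zero => simp [pderivIter]
    | succ j ih =>
      simp only [pderivIter, Function.iterate_succ_apply'] at ih ⊢
      rw [ih]
      funext x
      simp only [pderiv]
      rw [fderiv_fun_neg]
      simp
  rw [this]

lemma aux_growth (d s : ℕ) (α : Fin d → ℕ) (f₀ : (Fin d → ℝ) → ℝ) (x₀ : Fin d → ℝ)
    (hA1 : AssumptionA1 d s α f₀ x₀) (k : Fin d) (hk : (k : ℕ) < s) :
    ∃ c ε : ℝ, 0 < c ∧ 0 < ε ∧ ∀ δ < ε, ∀ x ∈ Set.Icc (0 : Fin d → ℝ) 1, x₀ ≤ x →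
      f₀ x < f₀ x₀ + δ → c * (x k - x₀ k) ^ (α k) ≤ δ := by
  obtain ⟨-, hx01, hmono, hα, ⟨U, hU, hxU, hsm⟩, hder, -⟩ := hA1
  obtain ⟨h0, h1⟩ := hder k hk
  obtain ⟨m, hm⟩ : ∃ m, α k = m + 1 := ⟨α k - 1, by have := hα k hk; omega⟩
  rw [hm] at h0 h1 ⊢
  simp only [Nat.add_sub_cancel] at h0
  have hsm' : ContDiffOn ℝ ((m + 1 : ℕ)) f₀ U := by
    refine hsm.of_le ?_
    have : m + 1 ≤ (Finset.univ.filter (fun k : Fin d => (k : ℕ) < s)).sup α := by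
      rw [← hm]; exact Finset.le_sup (by simpa using hk)
    exact_mod_cast this
  have hx0I : x₀ ∈ Set.Icc (0 : Fin d → ℝ) 1 := ⟨fun i => (hx01 i).1.le, fun i => (hx01 i).2.le⟩
  have hle : ∀ t : ℝ, 0 ≤ t → x₀ ≤ x₀ + t • (Pi.single k 1 : Fin d → ℝ) := by
    intro t ht i
    by_cases hi : i = k
    · subst hi; simp [ht]
    · simp [hi]
  have hmem : ∀ t : ℝ, 0 ≤ t → t ≤ 1 - x₀ k →
      x₀ + t • (Pi.single k 1 : Fin d → ℝ) ∈ Set.Icc (0 : Fin d → ℝ) 1 := by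
    intro t ht ht'
    refine ⟨hx0I.1.trans (hle t ht), fun i => ?_⟩
    by_cases hi : i = k
    · subst hi; simp; linarith
    · simp [hi, (hx01 i).2.le]
  obtain ⟨C, η, hC, hη, H⟩ : ∃ C η : ℝ, 0 < C ∧ 0 < η ∧ ∀ t ∈ Set.Icc 0 η,
      f₀ x₀ + C * t ^ (m + 1) ≤ f₀ (x₀ + t • Pi.single k 1) := by
    rcases lt_or_gt_of_ne h1 with hneg | hpos
    · exfalso
      obtain ⟨C, η, hC, hη, H⟩ := aux_line d k m (fun x => - f₀ x) x₀ U hU hxU hsm'.neg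
        (fun j a b => by rw [aux_neg, h0 j a b, neg_zero]) (by rw [aux_neg]; linarith)
      set t := min η (1 - x₀ k) with ht
      have ht0 : 0 < t := lt_min hη (by linarith [(hx01 k).2])
      have := H t ⟨ht0.le, min_le_left _ _⟩
      have h3 := hmono hx0I (hmem t ht0.le (min_le_right _ _)) (hle t ht0.le)
      have : 0 < C * t ^ (m + 1) := by positivity
      linarith
    · exact aux_line d k m f₀ x₀ U hU hxU hsm' h0 hpos
  set η' := min η (1 - x₀ k) with hη'
  have ht0 : 0 < η' := lt_min hη (by linarith [(hx01 k).2])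
  refine ⟨C, C * η' ^ (m + 1), hC, by positivity, ?_⟩
  intro δ hδ x hx hxx hfx
  have hgen : ∀ t, 0 ≤ t → t ≤ η' → t ≤ x k - x₀ k → C * t ^ (m + 1) < δ := by
    intro t h1 h2 h3
    have a1 := H t ⟨h1, h2.trans (min_le_left _ _)⟩
    have a2 : f₀ (x₀ + t • Pi.single k 1) ≤ f₀ x := by
      refine hmono (hmem t h1 (h2.trans (min_le_right _ _))) hx fun i => ?_
      by_cases hi : i = k
      · subst hi; simp; linarith
      · simpa [hi] using hxx i
    linarith
  rcases le_total (x k - x₀ k) η' with h | h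
  · exact (hgen _ (by linarith [hxx k]) h le_rfl).le
  · exact absurd (hgen η' ht0.le le_rfl h) (by linarith)
lemma aux_exp (d s : ℕ) (α : Fin d → ℕ) (hα : ∀ k : Fin d, (k : ℕ) < s → 1 ≤ α k)
    (β : Fin d → ℝ) (hβ : ∀ k, β k ∈ Set.Ioo (0 : ℝ) 1)
    (hord : ∀ k k' : Fin d, k ≤ k' → (k' : ℕ) < s → (α k : ℝ) * β k ≤ (α k' : ℝ) * β k')
    (κ : Fin d) (w : Fin d → ℝ) (hw : w = fun k : Fin d => if (k : ℕ) < s then ((α k : ℝ))⁻¹ else 0)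
    (ρ : ℝ) (hρ : ρ = (∑ k ∈ Finset.Ici κ, β k) / (2 + ∑ k ∈ Finset.Ici κ, w k))
    (hκ : ∀ ℓ : Fin d, (∑ k ∈ Finset.Ici ℓ, β k) / (2 + ∑ k ∈ Finset.Ici ℓ, w k) ≤ ρ) :
    (∀ k, k < κ → (k : ℕ) < s ∧ β k ≤ ρ * w k) ∧ (∀ k, κ ≤ k → ρ * w k ≤ β k) := by
  have hw0 : ∀ k, 0 ≤ w k := by
    intro k; rw [hw]; simp only; split_ifs <;> positivity
  have hpos : ∀ S : Finset (Fin d), 0 < 2 + ∑ k ∈ S, w k := fun S => by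
    have := Finset.sum_nonneg (fun k (_ : k ∈ S) => hw0 k); linarith
  have hB0 : ∀ S : Finset (Fin d), 0 ≤ ∑ k ∈ S, β k := fun S =>
    Finset.sum_nonneg (fun k _ => (hβ k).1.le)
  have hρ0 : 0 ≤ ρ := by rw [hρ]; exact div_nonneg (hB0 _) (hpos _).le
  have hB : ∑ k ∈ Finset.Ici κ, β k = ρ * (2 + ∑ k ∈ Finset.Ici κ, w k) := by
    rw [hρ, div_mul_cancel₀ _ (hpos _).ne']
  have hsplit : ∀ (g : Fin d → ℝ) (p : Fin d),
      ∑ k ∈ Finset.Ici p, g k = g p + ∑ k ∈ Finset.Ioi p, g k := by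
    intro g p
    rw [← Finset.Ioi_insert, Finset.sum_insert (by simp)]
  have hle : ∀ ℓ : Fin d, (∑ k ∈ Finset.Ici ℓ, β k) ≤ ρ * (2 + ∑ k ∈ Finset.Ici ℓ, w k) :=
    fun ℓ => (div_le_iff₀ (hpos _)).1 (hκ ℓ)
  constructor
  · intro k hk
    have hk' : (k : ℕ) < κ := hk
    let p : Fin d := ⟨(κ : ℕ) - 1, by omega⟩
    have hI : Finset.Ioi p = Finset.Ici κ := by
      ext j
      simp only [Finset.mem_Ioi, Finset.mem_Ici, Fin.lt_def, Fin.le_def, p]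
      omega
    have h1 := hle p
    rw [hsplit, hsplit, hI, hB] at h1
    have hp : β p ≤ ρ * w p := by linarith
    have hps : (p : ℕ) < s := by
      by_contra hc
      rw [hw] at hp
      simp only [hc, if_false, mul_zero] at hp
      linarith [(hβ p).1]
    have hkp : k ≤ p := by rw [Fin.le_def]; simp only [p]; omega
    have hks : (k : ℕ) < s := lt_of_le_of_lt hkp hps
    refine ⟨hks, ?_⟩
    have h2 := hord k p hkp hps
    rw [hw] at hp ⊢
    simp only [hps, hks, if_true] at hp ⊢
    have ak : (0:ℝ) < α k := by exact_mod_cast hα k hks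
    have ap : (0:ℝ) < α p := by exact_mod_cast hα p hps
    rw [← div_eq_mul_inv, le_div_iff₀ ap] at hp
    rw [← div_eq_mul_inv, le_div_iff₀ ak]
    linarith
  · intro k hk
    by_cases hks : (k : ℕ) < s
    · have hκs : (κ : ℕ) < s := lt_of_le_of_lt hk hks
      have hB' : ∑ k ∈ Finset.Ioi κ, β k ≤ ρ * (2 + ∑ k ∈ Finset.Ioi κ, w k) := by
        by_cases hlast : (κ : ℕ) + 1 < d
        · let p : Fin d := ⟨(κ : ℕ) + 1, hlast⟩
          have hI : Finset.Ioi κ = Finset.Ici p := by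
            ext j
            simp only [Finset.mem_Ioi, Finset.mem_Ici, Fin.lt_def, Fin.le_def, p]
            omega
          rw [hI]; exact hle p
        · have hI : Finset.Ioi κ = ∅ := by
            ext j
            simp only [Finset.mem_Ioi, Fin.lt_def, Finset.notMem_empty, iff_false]
            omega
          rw [hI]; simp; linarith
      rw [hsplit, hsplit] at hB
      have hp : ρ * w κ ≤ β κ := by linarith
      have h2 := hord κ k hk hks
      rw [hw] at hp ⊢
      simp only [hκs, hks, if_true] at hp ⊢
      have ak : (0:ℝ) < α k := by exact_mod_cast hα k hks
      have ap : (0:ℝ) < α κ := by exact_mod_cast hα κ hκs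
      rw [← div_eq_mul_inv, div_le_iff₀ ap] at hp
      rw [← div_eq_mul_inv, div_le_iff₀ ak]
      linarith
    · rw [hw]; simp only [hks, if_false, mul_zero]; exact (hβ k).1.le

lemma aux_count (d s : ℕ) (α : Fin d → ℕ) (hα : ∀ k : Fin d, (k : ℕ) < s → 1 ≤ α k)
    (β : Fin d → ℝ) (a : ℕ → Fin d → ℝ) (n : ℕ) (x₀ : Fin d → ℝ)
    (i0 : ∀ k : Fin d, Fin (latticeDim d β n k)) (hi0 : latticePt d β a n i0 = x₀)
    (P : (∀ k : Fin d, Fin (latticeDim d β n k)) → Prop) [DecidablePred P] (c : Fin d → ℝ) (hc : ∀ k, 0 < c k)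
    (δ : ℝ) (hδ : 0 < δ)
    (hP : ∀ i, P i → x₀ ≤ latticePt d β a n i ∧ ∀ k : Fin d, (k : ℕ) < s →
      c k * (latticePt d β a n i k - x₀ k) ^ (α k) ≤ δ) :
    ((Finset.univ.filter P).card : ℝ) ≤ ∏ k : Fin d, if (k : ℕ) < s then
      (latticeDim d β n k : ℝ) * (δ / c k) ^ ((α k : ℝ)⁻¹) + 1 else (latticeDim d β n k : ℝ) := by
  classical
  let S : ∀ k : Fin d, Finset (Fin (latticeDim d β n k)) := fun k =>
    Finset.univ.filter (fun j => i0 k ≤ j ∧ ((k : ℕ) < s →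
      ((j : ℕ) : ℝ) - ((i0 k : ℕ) : ℝ) ≤ (latticeDim d β n k : ℝ) * (δ / c k) ^ ((α k : ℝ)⁻¹)))
  have hN : ∀ k, (0 : ℝ) < latticeDim d β n k := fun k => by
    exact_mod_cast (Nat.zero_le _).trans_lt (i0 k).2
  have hsub : Finset.univ.filter P ⊆ Fintype.piFinset S := by
    intro i hi
    obtain ⟨h1, h2⟩ := hP i (by simpa using hi)
    rw [Fintype.mem_piFinset]
    intro k
    have hdiff : latticePt d β a n i k - x₀ k =
        (((i k : ℕ) : ℝ) - ((i0 k : ℕ) : ℝ)) / (latticeDim d β n k : ℝ) := by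
      rw [← hi0]; simp only [latticePt]; ring
    have hnn : 0 ≤ latticePt d β a n i k - x₀ k := sub_nonneg.2 (h1 k)
    simp only [S, Finset.mem_filter, Finset.mem_univ, true_and]
    constructor
    · rw [hdiff] at hnn
      have := mul_nonneg hnn (hN k).le
      rw [div_mul_cancel₀ _ (hN k).ne'] at this
      rw [Fin.le_def]
      have : ((i0 k : ℕ) : ℝ) ≤ ((i k : ℕ) : ℝ) := by linarith
      exact_mod_cast this
    · intro hk
      have h3 := h2 k hk
      have ak : (α k) ≠ 0 := by have := hα k hk; omega
      have : latticePt d β a n i k - x₀ k ≤ (δ / c k) ^ ((α k : ℝ)⁻¹) := by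
        rw [← Real.pow_rpow_inv_natCast hnn ak]
        apply Real.rpow_le_rpow (by positivity) _ (by positivity)
        rw [le_div_iff₀ (hc k)]; linarith
      rw [hdiff, div_le_iff₀ (hN k)] at this
      linarith
  have h1 : ((Finset.univ.filter P).card : ℝ) ≤ ∏ k, ((S k).card : ℝ) := by
    have := Finset.card_le_card hsub
    rw [Fintype.card_piFinset] at this
    exact_mod_cast this
  refine h1.trans (Finset.prod_le_prod (fun k _ => by positivity) fun k _ => ?_)
  split_ifs with hk
  · set y := (latticeDim d β n k : ℝ) * (δ / c k) ^ ((α k : ℝ)⁻¹) with hy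
    have hy0 : 0 ≤ y := mul_nonneg (hN k).le (Real.rpow_nonneg (div_pos hδ (hc k)).le _)
    have : (S k).card ≤ (Finset.range (⌊y⌋₊ + 1)).card := by
      refine Finset.card_le_card_of_injOn (fun j => (j : ℕ) - (i0 k : ℕ)) ?_ ?_
      · intro j hj
        simp only [S, Finset.coe_filter, Finset.mem_univ, true_and, Set.mem_ofPred_eq] at hj
        have h2 := hj.2 hk
        have h3 : (i0 k : ℕ) ≤ j := hj.1
        simp only [Finset.coe_range, Set.mem_Iio]
        refine Nat.lt_succ_of_le (Nat.le_floor ?_)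
        rw [Nat.cast_sub h3]; exact h2
      · intro j hj j' hj' hjj
        simp only [S, Finset.coe_filter, Finset.mem_univ, true_and, Set.mem_ofPred_eq] at hj hj'
        have h3 : (i0 k : ℕ) ≤ j := hj.1
        have h4 : (i0 k : ℕ) ≤ j' := hj'.1
        simp only at hjj
        apply Fin.ext; omega
    rw [Finset.card_range] at this
    have h5 : ((S k).card : ℝ) ≤ ⌊y⌋₊ + 1 := by exact_mod_cast this
    linarith [Nat.floor_le hy0]
  · have : (S k).card ≤ latticeDim d β n k := by
      simpa using Finset.card_le_univ (S k)
    exact_mod_cast this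

lemma aux_prod (d s : ℕ) (α : Fin d → ℕ) (hα : ∀ k : Fin d, (k : ℕ) < s → 1 ≤ α k)
    (β : Fin d → ℝ) (hβ : ∀ k, β k ∈ Set.Ioo (0 : ℝ) 1)
    (hord : ∀ k k' : Fin d, k ≤ k' → (k' : ℕ) < s → (α k : ℝ) * β k ≤ (α k' : ℝ) * β k')
    (κ : Fin d) (w : Fin d → ℝ) (hw : w = fun k : Fin d => if (k : ℕ) < s then ((α k : ℝ))⁻¹ else 0)
    (ρ : ℝ) (hρ : ρ = (∑ k ∈ Finset.Ici κ, β k) / (2 + ∑ k ∈ Finset.Ici κ, w k))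
    (hκ : ∀ ℓ : Fin d, (∑ k ∈ Finset.Ici ℓ, β k) / (2 + ∑ k ∈ Finset.Ici ℓ, w k) ≤ ρ)
    (c : Fin d → ℝ) (hc : ∀ k, 0 < c k) (D : ℝ) (hD : 0 < D) (n : ℕ) (hn : 1 ≤ n) :
    (∏ k : Fin d, if (k : ℕ) < s then
      (latticeDim d β n k : ℝ) * (D * (n : ℝ) ^ (-ρ) / c k) ^ ((α k : ℝ)⁻¹) + 1
        else (latticeDim d β n k : ℝ)) * (D * (n : ℝ) ^ (-ρ)) ^ 2 ≤
      (∏ k : Fin d, ((D / c k) ^ ((α k : ℝ)⁻¹) + 1)) * D ^ 2 := by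
  obtain ⟨E1, E2⟩ := aux_exp d s α hα β hβ hord κ w hw ρ hρ hκ
  have hn0 : (0 : ℝ) < n := by exact_mod_cast hn
  have hn1 : (1 : ℝ) ≤ n := by exact_mod_cast hn
  have hw0 : ∀ k, 0 ≤ w k := by
    intro k; rw [hw]; simp only; split_ifs <;> positivity
  have hpos : 0 < 2 + ∑ k ∈ Finset.Ici κ, w k := by
    have := Finset.sum_nonneg (fun k (_ : k ∈ Finset.Ici κ) => hw0 k); linarith
  let e : Fin d → ℝ := fun k => if κ ≤ k then β k - ρ * w k else 0
  have hsum : ∑ k, e k = 2 * ρ := by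
    simp only [e]
    rw [← Finset.sum_filter]
    have : Finset.univ.filter (fun k => κ ≤ k) = Finset.Ici κ := by ext; simp
    rw [this, Finset.sum_sub_distrib, ← Finset.mul_sum]
    have : ∑ k ∈ Finset.Ici κ, β k = ρ * (2 + ∑ k ∈ Finset.Ici κ, w k) := by
      rw [hρ, div_mul_cancel₀ _ hpos.ne']
    rw [this]; ring
  have hdim : ∀ k, (latticeDim d β n k : ℝ) ≤ (n : ℝ) ^ (β k) := fun k =>
    Nat.floor_le (by positivity)
  have hfac : ∀ k : Fin d, (if (k : ℕ) < s then
      (latticeDim d β n k : ℝ) * (D * (n : ℝ) ^ (-ρ) / c k) ^ ((α k : ℝ)⁻¹) + 1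
        else (latticeDim d β n k : ℝ)) ≤ ((D / c k) ^ ((α k : ℝ)⁻¹) + 1) * (n : ℝ) ^ (e k) := by
    intro k
    have hDc : 0 < D / c k := div_pos hD (hc k)
    have hC0 : 0 ≤ (D / c k) ^ ((α k : ℝ)⁻¹) := by positivity
    split_ifs with hk
    · have hwk : w k = (α k : ℝ)⁻¹ := by rw [hw]; simp [hk]
      have h1 : (D * (n : ℝ) ^ (-ρ) / c k) ^ ((α k : ℝ)⁻¹) =
          (D / c k) ^ ((α k : ℝ)⁻¹) * (n : ℝ) ^ (-(ρ * w k)) := by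
        rw [show D * (n : ℝ) ^ (-ρ) / c k = (D / c k) * (n : ℝ) ^ (-ρ) by ring,
          Real.mul_rpow hDc.le (by positivity), ← Real.rpow_mul hn0.le, hwk]
        ring_nf
      have h2 : (latticeDim d β n k : ℝ) * (D * (n : ℝ) ^ (-ρ) / c k) ^ ((α k : ℝ)⁻¹) ≤
          (D / c k) ^ ((α k : ℝ)⁻¹) * (n : ℝ) ^ (β k - ρ * w k) := by
        rw [h1, sub_eq_add_neg, Real.rpow_add hn0]
        have := mul_le_mul_of_nonneg_right (hdim k)
          (by positivity : 0 ≤ (D / c k) ^ ((α k : ℝ)⁻¹) * (n : ℝ) ^ (-(ρ * w k)))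
        linarith
      have h3 : (n : ℝ) ^ (β k - ρ * w k) ≤ (n : ℝ) ^ (e k) := by
        apply Real.rpow_le_rpow_of_exponent_le hn1
        simp only [e]
        split_ifs with hkk
        · exact le_rfl
        · linarith [(E1 k (not_le.1 hkk)).2]
      have h4 : (1 : ℝ) ≤ (n : ℝ) ^ (e k) := by
        apply Real.one_le_rpow hn1
        simp only [e]
        split_ifs with hkk
        · linarith [E2 k hkk]
        · exact le_rfl
      have := mul_le_mul_of_nonneg_left h3 hC0
      linarith
    · have hkκ : κ ≤ k := by
        by_contra hcon
        exact hk (E1 k (not_le.1 hcon)).1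
      have hwk : w k = 0 := by rw [hw]; simp [hk]
      have : e k = β k := by simp [e, hkκ, hwk]
      rw [this]
      refine (hdim k).trans ?_
      have : 0 ≤ (n : ℝ) ^ (β k) := by positivity
      nlinarith
  have hprod := Finset.prod_le_prod (s := Finset.univ) (fun k _ => by
    split_ifs
    · have := hc k; positivity
    · positivity) (fun k _ => hfac k)
  rw [Finset.prod_mul_distrib, ← Real.rpow_sum_of_pos hn0, hsum] at hprod
  calc _ ≤ ((∏ k : Fin d, ((D / c k) ^ ((α k : ℝ)⁻¹) + 1)) * (n : ℝ) ^ (2 * ρ)) *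
        (D * (n : ℝ) ^ (-ρ)) ^ 2 := mul_le_mul_of_nonneg_right hprod (by positivity)
    _ = _ := by
      have : (n : ℝ) ^ (2 * ρ) * ((n : ℝ) ^ (-ρ)) ^ 2 = 1 := by
        rw [← Real.rpow_natCast, ← Real.rpow_mul hn0.le, ← Real.rpow_add hn0]
        convert Real.rpow_zero _ using 2
        push_cast; ring
      linear_combination (∏ k : Fin d, ((D / c k) ^ ((α k : ℝ)⁻¹) + 1)) * D ^ 2 * this
lemma aux_inj (d : ℕ) (β : Fin d → ℝ) (a : ℕ → Fin d → ℝ) (n : ℕ) :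
    Function.Injective (latticePt d β a n) := by
  intro i j h
  funext k
  have hN : (0 : ℝ) < latticeDim d β n k := by
    exact_mod_cast (Nat.zero_le _).trans_lt (i k).2
  have := congrFun h k
  simp only [latticePt, add_right_inj] at this
  rw [div_left_inj' hN.ne'] at this
  apply Fin.ext
  exact_mod_cast this

lemma aux_mem (d : ℕ) (β : Fin d → ℝ) (a : ℕ → Fin d → ℝ) (n : ℕ) (ha : ∀ k, 0 ≤ a n k)
    (ha' : ∀ k, a n k + ((latticeDim d β n k : ℝ) - 1) / (latticeDim d β n k : ℝ) ≤ 1)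
    (i : ∀ k : Fin d, Fin (latticeDim d β n k)) :
    latticePt d β a n i ∈ Set.Icc (0 : Fin d → ℝ) 1 := by
  constructor
  · intro k
    have := ha k
    simp only [latticePt, Pi.zero_apply]
    positivity
  · intro k
    refine le_trans ?_ (ha' k)
    simp only [latticePt]
    gcongr
    have : ((i k : ℕ) : ℝ) + 1 ≤ latticeDim d β n k := by exact_mod_cast (i k).2
    linarith

/-- Two-point reduction. -/
lemma aux_lecam {ι : Type*} [Fintype ι] (i0 : ι) (σ : ℝ) (hσ : 0 < σ) (m1 m2 : ι → ℝ)
    (h : ∀ i, i ≠ i0 → m1 i = m2 i) (h1 : m2 i0 ≤ m1 i0) (h2 : m1 i0 ≤ m2 i0 + σ)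
    (T : (ι → ℝ) → ℝ) (hT : Measurable T) (R : ℝ) (hR : 0 ≤ R) (S : ENNReal)
    (hR1 : R * (m1 i0 - m2 i0) = 1)
    (hS1 : ENNReal.ofReal R * ∫⁻ y, ENNReal.ofReal |T y - m1 i0|
      ∂(Measure.pi fun i => ProbabilityTheory.gaussianReal (m1 i) ((σ ^ 2).toNNReal)) ≤ S)
    (hS2 : ENNReal.ofReal R * ∫⁻ y, ENNReal.ofReal |T y - m2 i0|
      ∂(Measure.pi fun i => ProbabilityTheory.gaussianReal (m2 i) ((σ ^ 2).toNNReal)) ≤ S) :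
    ENNReal.ofReal ((√(2 * Real.pi))⁻¹ * Real.exp (-1 / 2) / 2) ≤ S := by
  obtain ⟨Q, hQ, hQ1, hQ2⟩ := aux_twopoint i0 σ hσ m1 m2 h h1 h2
  have key : ENNReal.ofReal ((√(2 * Real.pi))⁻¹ * Real.exp (-1 / 2)) ≤ S + S := by
    calc ENNReal.ofReal ((√(2 * Real.pi))⁻¹ * Real.exp (-1 / 2)) = Q Set.univ := hQ.symm
      _ = ENNReal.ofReal R * ∫⁻ _, ENNReal.ofReal (m1 i0 - m2 i0) ∂Q := by
          rw [lintegral_const, ← mul_assoc, ← ENNReal.ofReal_mul hR, hR1]; simp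
      _ ≤ ENNReal.ofReal R * ∫⁻ y, (ENNReal.ofReal |T y - m1 i0| + ENNReal.ofReal |T y - m2 i0|) ∂Q := by
          gcongr with y
          rw [← ENNReal.ofReal_add (abs_nonneg _) (abs_nonneg _)]
          apply ENNReal.ofReal_le_ofReal
          have e1 := neg_abs_le (T y - m1 i0)
          have e2 := le_abs_self (T y - m2 i0)
          linarith
      _ = ENNReal.ofReal R * ∫⁻ y, ENNReal.ofReal |T y - m1 i0| ∂Q +
          ENNReal.ofReal R * ∫⁻ y, ENNReal.ofReal |T y - m2 i0| ∂Q := by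
          rw [lintegral_add_left (by fun_prop), mul_add]
      _ ≤ S + S := by
          refine add_le_add (le_trans ?_ hS1) (le_trans ?_ hS2)
          · gcongr
          · gcongr
  rw [ENNReal.ofReal_div_of_pos (by norm_num)]
  apply ENNReal.div_le_of_le_mul
  rw [show ENNReal.ofReal 2 = 2 by simp, mul_two]
  exact key

open ProbabilityTheory in
/-- Theorem 2 of the paper, first claim (local asymptotic minimax lower bound),
fixed lattice design with Gaussian errors: there is a constant `L > 0`, independent of
the lattice parameters and the noise level, lower-bounding the normalized local minimax
risk over an `ℓ₂`-ball of radius `√(τσ²/n)` around `f₀`. -/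
theorem stmt10 (d s : ℕ) (hd : 1 ≤ d) (α : Fin d → ℕ)
    (x₀ : Fin d → ℝ) (f₀ : (Fin d → ℝ) → ℝ)
    (hA1 : AssumptionA1 d s α f₀ x₀) :
    ∃ L : ℝ, 0 < L ∧
      ∀ (β : Fin d → ℝ), (∀ k, β k ∈ Set.Ioo (0 : ℝ) 1) → (∑ k : Fin d, β k = 1) →
      (∀ k k' : Fin d, k ≤ k' → (k' : ℕ) < s → (α k : ℝ) * β k ≤ (α k' : ℝ) * β k') →
      ∀ (a : ℕ → Fin d → ℝ), (∀ n k, 0 ≤ a n k) →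
      (∀ n k, a n k + ((latticeDim d β n k : ℝ) - 1) / (latticeDim d β n k : ℝ) ≤ 1) →
      (∀ n : ℕ, 1 ≤ n →
        ∃ v : ∀ k : Fin d, Fin (latticeDim d β n k), latticePt d β a n v = x₀) →
      ∀ (κ : Fin d),
      (∀ ℓ : Fin d,
        (∑ k ∈ Finset.Ici ℓ, β k) /
            (2 + ∑ k ∈ Finset.Ici ℓ, if (k : ℕ) < s then ((α k : ℝ))⁻¹ else 0) ≤
          (∑ k ∈ Finset.Ici κ, β k) /
            (2 + ∑ k ∈ Finset.Ici κ, if (k : ℕ) < s then ((α k : ℝ))⁻¹ else 0)) →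
      ∀ (σ : ℝ), 0 < σ →
      ENNReal.ofReal L ≤
        ⨆ (τ : ℝ) (_ : 0 < τ),
          Filter.liminf (fun n : ℕ =>
            ⨅ (T : ((∀ k : Fin d, Fin (latticeDim d β n k)) → ℝ) → ℝ)
              (_ : Measurable T),
            ⨆ (f : (Fin d → ℝ) → ℝ)
              (_ : MonotoneOn f (Set.Icc (0 : Fin d → ℝ) 1))
              (_ : ((Fintype.card (∀ k : Fin d, Fin (latticeDim d β n k)) : ℝ))⁻¹ *
                  (∑ i : ∀ k : Fin d, Fin (latticeDim d β n k),
                    (f (latticePt d β a n i) - f₀ (latticePt d β a n i)) ^ 2) ≤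
                τ * σ ^ 2 / (Fintype.card (∀ k : Fin d, Fin (latticeDim d β n k)) : ℝ)),
              ENNReal.ofReal (((n : ℝ) ^ (∑ k ∈ Finset.Ici κ, β k) / σ ^ 2) ^
                  (1 / (2 + ∑ k ∈ Finset.Ici κ, if (k : ℕ) < s then ((α k : ℝ))⁻¹ else 0))) *
                ∫⁻ y, ENNReal.ofReal |T y - f x₀|
                  ∂(Measure.pi fun i : (∀ k : Fin d, Fin (latticeDim d β n k)) =>
                    gaussianReal (f (latticePt d β a n i)) ((σ ^ 2).toNNReal)))
            atTop := by
  obtain ⟨hsd, hx01, hmono, hα, hU, hder, hA⟩ := id hA1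
  refine ⟨(√(2 * Real.pi))⁻¹ * Real.exp (-1 / 2) / 2, by positivity, ?_⟩
  intro β hβ hβ1 hord a ha ha' hx κ hκ σ hσ
  have hx0I : x₀ ∈ Set.Icc (0 : Fin d → ℝ) 1 := ⟨fun i => (hx01 i).1.le, fun i => (hx01 i).2.le⟩
  have hg : ∀ k : Fin d, ∃ c ε : ℝ, 0 < c ∧ 0 < ε ∧ ((k : ℕ) < s → ∀ δ < ε,
      ∀ x ∈ Set.Icc (0 : Fin d → ℝ) 1, x₀ ≤ x →
      f₀ x < f₀ x₀ + δ → c * (x k - x₀ k) ^ (α k) ≤ δ) := by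
    intro k
    by_cases hk : (k : ℕ) < s
    · obtain ⟨c, ε, hc, hε, H⟩ := aux_growth d s α f₀ x₀ hA1 k hk
      exact ⟨c, ε, hc, hε, fun _ => H⟩
    · exact ⟨1, 1, one_pos, one_pos, fun h => absurd h hk⟩
  choose c ε hc hε H using hg
  set w : Fin d → ℝ := fun k : Fin d => if (k : ℕ) < s then ((α k : ℝ))⁻¹ else 0 with hw
  set A := 2 + ∑ k ∈ Finset.Ici κ, w k with hAdef
  set B := ∑ k ∈ Finset.Ici κ, β k with hBdef
  set ρ := B / A with hρ
  have hw0 : ∀ k, 0 ≤ w k := by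
    intro k; simp only [hw]; split_ifs <;> positivity
  have hApos : 0 < A := by
    have := Finset.sum_nonneg (fun k (_ : k ∈ Finset.Ici κ) => hw0 k); linarith
  have hBpos : 0 < B := Finset.sum_pos (fun k _ => (hβ k).1) ⟨κ, by simp⟩
  have hρpos : 0 < ρ := div_pos hBpos hApos
  set D := (σ ^ 2) ^ (1 / A) with hDdef
  have hD : 0 < D := by positivity
  set τ := (∏ k : Fin d, ((D / c k) ^ ((α k : ℝ)⁻¹) + 1)) * D ^ 2 / σ ^ 2 with hτ
  have hτpos : 0 < τ := by
    have : 0 < ∏ k : Fin d, ((D / c k) ^ ((α k : ℝ)⁻¹) + 1) :=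
      Finset.prod_pos fun k _ => by have := hc k; positivity
    positivity
  refine le_iSup₂_of_le τ hτpos ?_
  have hlim : Tendsto (fun n : ℕ => D * (n : ℝ) ^ (-ρ)) atTop (nhds 0) := by
    have := ((tendsto_rpow_neg_atTop hρpos).comp tendsto_natCast_atTop_atTop).const_mul D
    simpa using this
  refine le_liminf_of_le (by isBoundedDefault) ?_
  filter_upwards [hlim.eventually (gt_mem_nhds hσ),
    eventually_all.2 (fun k => hlim.eventually (gt_mem_nhds (hε k))), eventually_ge_atTop 1]
    with n hn1 hn2 hn3
  have hn0 : (0 : ℝ) < n := by exact_mod_cast hn3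
  set δ := D * (n : ℝ) ^ (-ρ) with hδdef
  have hδ : 0 < δ := by positivity
  obtain ⟨i0, hi0⟩ := hx n hn3
  refine le_iInf₂ fun T hT => ?_
  classical
  let f1 : (Fin d → ℝ) → ℝ := fun x => if x₀ ≤ x then max (f₀ x) (f₀ x₀ + δ) else f₀ x
  let f2 : (Fin d → ℝ) → ℝ := fun x => if x = x₀ then f₀ x₀ else f1 x
  have f1ge : ∀ x, f₀ x ≤ f1 x := by
    intro x; simp only [f1]; split_ifs
    · exact le_max_left _ _
    · exact le_rfl
  have f2le : ∀ x, f2 x ≤ f1 x := by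
    intro x; simp only [f2]; split_ifs with hxx
    · rw [hxx]; exact f1ge x₀
    · exact le_rfl
  have f2ge : ∀ x, f₀ x ≤ f2 x := by
    intro x; simp only [f2]; split_ifs with hxx
    · rw [hxx]
    · exact f1ge x
  have f1x : f1 x₀ = f₀ x₀ + δ := by simp [f1, hδ.le]
  have f2x : f2 x₀ = f₀ x₀ := by simp [f2]
  have m1 : MonotoneOn f1 (Set.Icc (0 : Fin d → ℝ) 1) := by
    intro x hx y hy hxy
    have := hmono hx hy hxy
    simp only [f1]
    split_ifs with p q q
    · exact max_le_max this le_rfl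
    · exact absurd (p.trans hxy) q
    · exact this.trans (le_max_left _ _)
    · exact this
  have m2 : MonotoneOn f2 (Set.Icc (0 : Fin d → ℝ) 1) := by
    intro x hx y hy hxy
    by_cases hy0 : y = x₀
    · by_cases hx0 : x = x₀
      · rw [hx0, hy0]
      · have hnot : ¬ x₀ ≤ x := fun hc => hx0 (le_antisymm (hxy.trans hy0.le) hc)
        have : f2 x = f₀ x := by simp [f2, f1, hx0, hnot]
        rw [this]
        exact (hmono hx hy hxy).trans (f2ge y)
    · have : f2 y = f1 y := by simp [f2, hy0]
      rw [this]
      exact (f2le x).trans (m1 hx hy hxy)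
  let P : (∀ k : Fin d, Fin (latticeDim d β n k)) → Prop := fun i =>
    x₀ ≤ latticePt d β a n i ∧ f₀ (latticePt d β a n i) < f₀ x₀ + δ
  have hmemI := aux_mem d β a n (ha n) (ha' n)
  have hcount := aux_count d s α hα β a n x₀ i0 hi0 P c hc δ hδ (fun i hi => ⟨hi.1, fun k hk =>
    H k hk δ (hn2 k) _ (hmemI i) hi.1 hi.2⟩)
  have hprod := aux_prod d s α hα β hβ hord κ w hw ρ hρ hκ c hc D hD n hn3
  have hball : ∀ g : (Fin d → ℝ) → ℝ, (∀ x, f₀ x ≤ g x) → (∀ x, g x ≤ f1 x) →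
      ((Fintype.card (∀ k : Fin d, Fin (latticeDim d β n k)) : ℝ))⁻¹ *
                  (∑ i : ∀ k : Fin d, Fin (latticeDim d β n k),
                    (g (latticePt d β a n i) - f₀ (latticePt d β a n i)) ^ 2) ≤
                τ * σ ^ 2 / (Fintype.card (∀ k : Fin d, Fin (latticeDim d β n k)) : ℝ) := by
    intro g g1 g2
    rw [div_eq_inv_mul]
    refine mul_le_mul_of_nonneg_left ?_ (by positivity)
    calc _ ≤ ∑ i : ∀ k : Fin d, Fin (latticeDim d β n k), (if P i then δ ^ 2 else 0) := by
          refine Finset.sum_le_sum fun i _ => ?_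
          have e1 := g1 (latticePt d β a n i)
          have e2 := g2 (latticePt d β a n i)
          split_ifs with hPi
          · have : f1 (latticePt d β a n i) = f₀ x₀ + δ := by
              simp only [f1, hPi.1, if_true]; exact max_eq_right hPi.2.le
            have e3 := hmono hx0I (hmemI i) hPi.1
            exact pow_le_pow_left₀ (by linarith) (by linarith) 2
          · have : f1 (latticePt d β a n i) = f₀ (latticePt d β a n i) := by
              simp only [f1]
              split_ifs with hle
              · exact max_eq_left (not_lt.1 fun hc => hPi ⟨hle, hc⟩)
              · rfl
            have : g (latticePt d β a n i) - f₀ (latticePt d β a n i) = 0 := by linarith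
            rw [this]; norm_num
      _ = ((Finset.univ.filter P).card : ℝ) * δ ^ 2 := by
          rw [← Finset.sum_filter, Finset.sum_const, nsmul_eq_mul]
      _ ≤ _ := mul_le_mul_of_nonneg_right hcount (by positivity)
      _ ≤ _ := hprod
      _ = τ * σ ^ 2 := by rw [hτ]; field_simp
  have hR1 : ((n : ℝ) ^ B / σ ^ 2) ^ (1 / A) * (f1 x₀ - f2 x₀) = 1 := by
    rw [f1x, f2x, Real.div_rpow (by positivity) (by positivity), ← Real.rpow_mul hn0.le, hδdef,
      mul_one_div, ← hρ, ← hDdef, Real.rpow_neg hn0.le]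
    have : (n : ℝ) ^ ρ ≠ 0 := by positivity
    field_simp
    ring
  refine aux_lecam i0 σ hσ (fun i => f1 (latticePt d β a n i)) (fun i => f2 (latticePt d β a n i))
    ?_ ?_ ?_ T hT (((n : ℝ) ^ B / σ ^ 2) ^ (1 / A)) (by positivity) _ ?_ ?_ ?_
  · intro i hi
    have : latticePt d β a n i ≠ x₀ := fun hc => hi (aux_inj d β a n (hc.trans hi0.symm))
    simp [f2, this]
  · exact f2le _
  · simp only [hi0, f1x, f2x]; linarith
  · simpa only [hi0] using hR1
  · simp only [hi0]
    exact le_iSup_of_le f1 (le_iSup₂_of_le m1 (hball f1 f1ge fun _ => le_rfl) le_rfl)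
  · simp only [hi0]
    exact le_iSup_of_le f2 (le_iSup₂_of_le m2 (hball f2 f2ge f2le) le_rfl)
end

section
/- Let d ≥ 1, let α_1,…,α_d be positive integers, x₀ ∈ (0,1)^d, τ > 0 and σ > 0. For n ≥ 1 set ω_n = n^{−1/(2 + Σ_{k=1}^d α_k^{−1})} and r_n = (ω_n^{1/α_1},…,ω_n^{1/α_d}). Let X_1,…,X_n be i.i.d. from a distribution P on [0,1]^d whose Lebesgue density is bounded above and below by positive constants, and let ξ_1,…,ξ_n be i.i.d. mean-zero random variables with variance σ², independent of the X_i. For a set A ⊆ ℝ^d, let ξ̄|_A denote the average of the ξ_i over {i : X_i ∈ A} (set to 0 when no X_i lies in A). Then sup_{h ∈ ℝ_{≥0}^d} | ξ̄|_{[x₀ − h⊙r_n, x₀ + τ·r_n]} | = O_P(ω_n) as n → ∞, where ⊙ denotes coordinatewise product and [a,b] = ∏_k [min(a_k,b_k), max(a_k,b_k)]. -/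
open MeasureTheory Filter

section MaxIneq

set_option linter.unusedSectionVars false

open scoped NNReal ENNReal

/-- maximal absolute partial sum over a family of index sets -/
noncomputable def maxS {ι : Type*} (F : Finset (Finset ι)) (x : ι → ℝ) : ℝ≥0 :=
  F.sup fun C => ‖∑ i ∈ C, x i‖₊

lemma measurable_finsup_nn {ι α : Type*} [MeasurableSpace α] (F : Finset ι) (f : ι → α → ℝ≥0)
    (hf : ∀ i, Measurable (f i)) : Measurable (fun a => F.sup fun i => f i a) := by
  classical
  induction F using Finset.induction_on with
  | empty => simp
  | insert a s ha ih => simp only [Finset.sup_insert]; exact (hf a).sup ih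

lemma measurable_maxS {ι : Type*} (F : Finset (Finset ι)) : Measurable (maxS F) := by
  unfold maxS
  refine measurable_finsup_nn F (fun C (x : ι → ℝ) => ‖∑ i ∈ C, x i‖₊) (fun C => ?_)
  fun_prop

variable {ι : Type*} [Fintype ι] [DecidableEq ι] (μ : Measure ℝ) [IsProbabilityMeasure μ]

lemma lintegral_le_of_update (i : ι) (f g : (ι → ℝ) → ℝ≥0∞) (hf : Measurable f)
    (hg : Measurable g)
    (h : ∀ x, ∫⁻ t, f (Function.update x i t) ∂μ ≤ ∫⁻ t, g (Function.update x i t) ∂μ) :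
    ∫⁻ x, f x ∂(Measure.pi fun _ : ι => μ) ≤ ∫⁻ x, g x ∂(Measure.pi fun _ : ι => μ) := by
  rw [lintegral_eq_lmarginal_univ (μ := fun _ : ι => μ) (0 : ι → ℝ),
    lintegral_eq_lmarginal_univ (μ := fun _ : ι => μ) (0 : ι → ℝ),
    lmarginal_erase' f hf (Finset.mem_univ i), lmarginal_erase' g hg (Finset.mem_univ i)]
  exact lmarginal_mono h _

lemma sum_update_aux (C : Finset ι) (i : ι) (x : ι → ℝ) (t : ℝ) :
    ∑ j ∈ C, Function.update x i t j = (∑ j ∈ C.erase i, x j) + (if i ∈ C then t else 0) := by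
  by_cases hi : i ∈ C
  · rw [← Finset.add_sum_erase _ _ hi]
    simp only [Function.update_self, hi, if_true]
    rw [add_comm]
    congr 1
    refine Finset.sum_congr rfl fun j hj => ?_
    rw [Function.update_of_ne (Finset.ne_of_mem_erase hj)]
  · simp only [hi, if_false, add_zero, Finset.erase_eq_of_notMem hi]
    refine Finset.sum_congr rfl fun j hj => ?_
    rw [Function.update_of_ne (by rintro rfl; exact hi hj)]

lemma jensen_aux (hint : Integrable (fun t : ℝ => t) μ) (hmean : ∫ x, x ∂μ = 0) (A : ℝ) (p : Prop)
    [Decidable p] :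
    (‖A‖₊ : ℝ≥0∞) ≤ ∫⁻ t, (‖A + (if p then t else 0)‖₊ : ℝ≥0∞) ∂μ := by
  have h1 := enorm_integral_le_lintegral_enorm (μ := μ) (fun t : ℝ => A + (if p then t else 0))
  have h2 : ∫ t, (A + (if p then t else 0)) ∂μ = A := by
    split_ifs
    · rw [integral_add (integrable_const _) hint, hmean]; simp
    · simp
  rw [h2] at h1
  exact h1

lemma maxS_sub (F : Finset (Finset ι)) (T : Finset ι) (x : ι → ℝ) :
    maxS (F.image (· ∩ T)) x = F.sup fun C => ‖∑ i ∈ C ∩ T, x i‖₊ := by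
  unfold maxS
  rw [Finset.sup_image]; rfl

lemma maxS_le_sum (F : Finset (Finset ι)) (x : ι → ℝ) : maxS F x ≤ ∑ i, ‖x i‖₊ := by
  unfold maxS
  refine Finset.sup_le fun C _ => (nnnorm_sum_le _ _).trans ?_
  exact Finset.sum_le_sum_of_subset (Finset.subset_univ _)

lemma doob_aux (hint : Integrable (fun t : ℝ => t) μ) (hmean : ∫ x, x ∂μ = 0)
    (hfin : ∫⁻ x, ((∑ i, ‖x i‖₊ : ℝ≥0) : ℝ≥0∞) ^ 2 ∂(Measure.pi fun _ : ι => μ) ≠ ⊤)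
    (F : Finset (Finset ι)) (f : ι → ℝ) (T : Finset ι) :
    ∃ m : (ι → ℝ) → ℝ≥0, Measurable m ∧ (∀ x i t, i ∉ T → m (Function.update x i t) = m x) ∧
      (∀ x, m x ≤ ∑ i, ‖x i‖₊) ∧
      (∀ x, ∀ C ∈ F, ∀ b : ℝ, ‖∑ i ∈ (C ∩ T).filter (fun i => b ≤ f i), x i‖₊ ≤ m x) ∧
      ∫⁻ x, (m x : ℝ≥0∞) ^ 2 ∂(Measure.pi fun _ : ι => μ) ≤
        2 * ∫⁻ x, (m x : ℝ≥0∞) * (maxS (F.image (· ∩ T)) x : ℝ≥0∞)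
          ∂(Measure.pi fun _ : ι => μ) := by
  classical
  induction T using Finset.induction_on_min_value f with
  | empty => exact ⟨fun _ => 0, measurable_const, by simp, by simp, by simp, by simp⟩
  | insert a T haT hmin ih =>
    obtain ⟨m, hm, hup, hle, hC, hint2⟩ := ih
    set s : (ι → ℝ) → ℝ≥0 := maxS (F.image (· ∩ T)) with hs
    set s' : (ι → ℝ) → ℝ≥0 := maxS (F.image (· ∩ insert a T)) with hs'
    have ms : Measurable s := measurable_maxS _
    have ms' : Measurable s' := measurable_maxS _
    set ν := Measure.pi fun _ : ι => μ with hν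
    refine ⟨fun x => max (m x) (s' x), hm.sup ms', ?_, ?_, ?_, ?_⟩
    · intro x i t hi
      have hi1 : i ≠ a := fun h => hi (by simp [h])
      have hi2 : i ∉ T := fun h => hi (by simp [h])
      simp only [hup x i t hi2, hs', maxS_sub]
      congr 2
      funext C
      rw [sum_update_aux, if_neg (fun h => hi (Finset.mem_inter.1 h).2),
        Finset.erase_eq_of_notMem (fun h => hi (Finset.mem_inter.1 h).2), add_zero]
    · intro x
      exact max_le (hle x) (maxS_le_sum _ _)
    · intro x C hCF b
      by_cases hb : b ≤ f a
      · refine le_max_of_le_right ?_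
        rw [hs', maxS_sub]
        rw [Finset.filter_true_of_mem]
        · exact Finset.le_sup (f := fun C => ‖∑ i ∈ C ∩ insert a T, x i‖₊) hCF
        · intro i hi
          rcases Finset.mem_insert.1 (Finset.mem_inter.1 hi).2 with h | h
          · rw [h]; exact hb
          · exact hb.trans (hmin i h)
      · refine le_max_of_le_left ?_
        have : (C ∩ insert a T).filter (fun i => b ≤ f i) =
            (C ∩ T).filter (fun i => b ≤ f i) := by
          ext i
          simp only [Finset.mem_filter, Finset.mem_inter, Finset.mem_insert]
          constructor
          · rintro ⟨⟨h1, h2 | h2⟩, h3⟩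
            · exact absurd (h2 ▸ h3) hb
            · exact ⟨⟨h1, h2⟩, h3⟩
          · rintro ⟨⟨h1, h2⟩, h3⟩; exact ⟨⟨h1, Or.inr h2⟩, h3⟩
        rw [this]
        exact hC x C hCF b
    · -- integral inequality
      have key : ∫⁻ x, (m x : ℝ≥0∞) * (s x : ℝ≥0∞) ∂ν ≤ ∫⁻ x, (m x : ℝ≥0∞) * (s' x : ℝ≥0∞) ∂ν := by
        refine lintegral_le_of_update μ a _ _ (by fun_prop) (by fun_prop) fun x => ?_
        simp only [hup x a _ haT]
        rw [lintegral_const_mul _ (by fun_prop), lintegral_const_mul _ (by fun_prop)]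
        gcongr 1
        have hsx : ∀ t, s (Function.update x a t) = s x := by
          intro t
          simp only [hs, maxS_sub]
          congr 1
          funext C
          rw [sum_update_aux, if_neg (fun h => haT (Finset.mem_inter.1 h).2),
            Finset.erase_eq_of_notMem (fun h => haT (Finset.mem_inter.1 h).2), add_zero]
        simp only [hsx, lintegral_const, measure_univ, mul_one]
        rw [hs, maxS_sub]
        by_cases hF : F.Nonempty
        · obtain ⟨C, hCF, hCe⟩ := Finset.exists_mem_eq_sup F hF (fun C => ‖∑ i ∈ C ∩ T, x i‖₊)
          rw [hCe]
          have := jensen_aux μ hint hmean (∑ i ∈ C ∩ T, x i) (a ∈ C ∩ insert a T)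
          refine this.trans (lintegral_mono fun t => ?_)
          have h1 : ‖∑ i ∈ C ∩ insert a T, Function.update x a t i‖₊ ≤ s' (Function.update x a t) := by
            rw [hs', maxS_sub]
            exact Finset.le_sup
              (f := fun C => ‖∑ i ∈ C ∩ insert a T, Function.update x a t i‖₊) hCF
          rw [sum_update_aux] at h1
          have h2 : (C ∩ insert a T).erase a = C ∩ T := by
            ext i
            simp only [Finset.mem_erase, Finset.mem_inter, Finset.mem_insert]
            constructor
            · rintro ⟨h1, h2, h3 | h3⟩
              · exact absurd h3 h1
              · exact ⟨h2, h3⟩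
            · rintro ⟨h1, h2⟩
              exact ⟨fun h => haT (h ▸ h2), h1, Or.inr h2⟩
          rw [h2] at h1
          exact ENNReal.coe_le_coe.2 h1
        · rw [Finset.not_nonempty_iff_eq_empty.1 hF]; simp
      have hfinite : 2 * ∫⁻ x, (m x : ℝ≥0∞) * (s' x : ℝ≥0∞) ∂ν ≠ ⊤ := by
        refine ENNReal.mul_ne_top (by simp) (ne_top_of_le_ne_top hfin (lintegral_mono fun x => ?_))
        simp only
        rw [sq]
        exact mul_le_mul' (ENNReal.coe_le_coe.2 (hle x)) (ENNReal.coe_le_coe.2 (maxS_le_sum _ _))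
      have hpt : ∀ x, ((max (m x) (s' x) : ℝ≥0) : ℝ≥0∞) ^ 2 + 2 * ((m x : ℝ≥0∞) * s' x) ≤
          2 * (((max (m x) (s' x) : ℝ≥0) : ℝ≥0∞) * s' x) + (m x : ℝ≥0∞) ^ 2 := by
        intro x
        norm_cast
        rw [← NNReal.coe_le_coe]
        push_cast
        rcases le_total (m x : ℝ) (s' x) with h | h
        · rw [max_eq_right h]; nlinarith [sq_nonneg ((m x : ℝ) - s' x)]
        · rw [max_eq_left h]; nlinarith
      have hI := lintegral_mono (μ := ν) hpt
      rw [lintegral_add_left (by fun_prop), lintegral_add_left (by fun_prop),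
        lintegral_const_mul _ (by fun_prop), lintegral_const_mul _ (by fun_prop)] at hI
      have h3 := hI.trans (add_le_add_right (hint2.trans (mul_le_mul_right key 2)) _)
      exact (ENNReal.add_le_add_iff_right hfinite).1 h3

lemma doob_step (hint : Integrable (fun t : ℝ => t) μ) (hmean : ∫ x, x ∂μ = 0)
    (hfin : ∫⁻ x, ((∑ i, ‖x i‖₊ : ℝ≥0) : ℝ≥0∞) ^ 2 ∂(Measure.pi fun _ : ι => μ) ≠ ⊤)
    (F F' : Finset (Finset ι)) (f : ι → ℝ)
    (hF : ∀ C' ∈ F', ∃ C ∈ F, ∃ b : ℝ, C' = C.filter (fun i => b ≤ f i)) :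
    ∫⁻ x, (maxS F' x : ℝ≥0∞) ^ 2 ∂(Measure.pi fun _ : ι => μ) ≤
      4 * ∫⁻ x, (maxS F x : ℝ≥0∞) ^ 2 ∂(Measure.pi fun _ : ι => μ) := by
  obtain ⟨m, hm, -, hle, hC, hI⟩ := doob_aux μ hint hmean hfin F f Finset.univ
  simp only [Finset.inter_univ, Finset.image_id'] at hC hI
  set ν := Measure.pi fun _ : ι => μ with hν
  have ms := measurable_maxS F
  have h1 : ∫⁻ x, (maxS F' x : ℝ≥0∞) ^ 2 ∂ν ≤ ∫⁻ x, (m x : ℝ≥0∞) ^ 2 ∂ν := by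
    refine lintegral_mono fun x => ?_
    have : maxS F' x ≤ m x := by
      refine Finset.sup_le fun C' hC' => ?_
      obtain ⟨C, hCF, b, rfl⟩ := hF C' hC'
      exact hC x C hCF b
    gcongr
  have hfm : ∫⁻ x, (m x : ℝ≥0∞) ^ 2 ∂ν ≠ ⊤ := by
    refine ne_top_of_le_ne_top hfin (lintegral_mono fun x => ?_)
    have := hle x
    simp only
    gcongr
  refine h1.trans ?_
  have hpt : ∀ x, 4 * ((m x : ℝ≥0∞) * maxS F x) ≤ (m x : ℝ≥0∞) ^ 2 + 4 * (maxS F x : ℝ≥0∞) ^ 2 := by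
    intro x
    norm_cast
    rw [← NNReal.coe_le_coe]
    push_cast
    nlinarith [sq_nonneg ((m x : ℝ) - 2 * maxS F x)]
  have hI2 := lintegral_mono (μ := ν) hpt
  rw [lintegral_const_mul _ (by fun_prop), lintegral_add_left (by fun_prop),
    lintegral_const_mul _ (by fun_prop)] at hI2
  have h3 : ∫⁻ x, (m x : ℝ≥0∞) ^ 2 ∂ν + ∫⁻ x, (m x : ℝ≥0∞) ^ 2 ∂ν ≤
      ∫⁻ x, (m x : ℝ≥0∞) ^ 2 ∂ν + 4 * ∫⁻ x, (maxS F x : ℝ≥0∞) ^ 2 ∂ν := by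
    refine le_trans ?_ hI2
    calc _ ≤ 2 * ∫⁻ x, (m x : ℝ≥0∞) * maxS F x ∂ν + 2 * ∫⁻ x, (m x : ℝ≥0∞) * maxS F x ∂ν :=
          add_le_add hI hI
      _ = _ := by ring
  exact (ENNReal.add_le_add_iff_left hfm).1 h3

lemma base_second_moment (σ : ℝ) (hmean : ∫ x, x ∂μ = 0) (hvar : ∫ x, x ^ 2 ∂μ = σ ^ 2)
    (hL : MemLp (fun t : ℝ => t) 2 μ) (W : Finset ι) :
    ∫⁻ x, (‖∑ i ∈ W, x i‖₊ : ℝ≥0∞) ^ 2 ∂(Measure.pi fun _ : ι => μ) =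
      ENNReal.ofReal (W.card * σ ^ 2) := by
  have hX : ∀ i : ι, MemLp (fun t : ℝ => if i ∈ W then t else 0) 2 μ := by
    intro i; split_ifs
    · exact hL
    · exact MemLp.zero
  have h := ProbabilityTheory.variance_sum_pi (μ := fun _ : ι => μ) hX
  have hv : ∀ i : ι, ProbabilityTheory.variance (fun t : ℝ => if i ∈ W then t else 0) μ =
      if i ∈ W then σ ^ 2 else 0 := by
    intro i; split_ifs
    · rw [ProbabilityTheory.variance_of_integral_eq_zero hL.aestronglyMeasurable.aemeasurable hmean,
        hvar]
    · exact ProbabilityTheory.variance_zero μ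
  have hsum : (∑ i : ι, fun x : ι → ℝ => if i ∈ W then x i else 0) = fun x => ∑ i ∈ W, x i := by
    funext x
    simp
  rw [hsum] at h
  simp only [hv, Finset.sum_ite_mem, Finset.univ_inter, Finset.sum_const, nsmul_eq_mul] at h
  have hL' : ∀ i : ι, MemLp (fun x : ι → ℝ => x i) 2 (Measure.pi fun _ : ι => μ) := fun i =>
    hL.comp_measurePreserving (measurePreserving_eval (fun _ : ι => μ) i)
  have hS : MemLp (fun x : ι → ℝ => ∑ i ∈ W, x i) 2 (Measure.pi fun _ : ι => μ) :=
    memLp_finsetSum _ fun i _ => hL' i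
  have hz : ∫ x : ι → ℝ, ∑ i ∈ W, x i ∂(Measure.pi fun _ : ι => μ) = 0 := by
    rw [integral_finsetSum _ fun i _ => (hL' i).integrable (by norm_num)]
    refine Finset.sum_eq_zero fun i _ => ?_
    have := integral_comp_eval (μ := fun _ : ι => μ) (i := i) (f := fun t : ℝ => t)
      (by fun_prop)
    rw [this, hmean]
  rw [← h, hS.ofReal_variance_eq, ProbabilityTheory.evariance]
  simp only [hz, sub_zero]
  rfl

end MaxIneq

section MaxIneq2

open scoped NNReal ENNReal

lemma max_second_moment {ι : Type*} [Fintype ι] [DecidableEq ι] (μ : Measure ℝ)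
    [IsProbabilityMeasure μ] (σ : ℝ) (hmean : ∫ x, x ∂μ = 0) (hvar : ∫ x, x ^ 2 ∂μ = σ ^ 2)
    (hL : MemLp (fun t : ℝ => t) 2 μ) (W : Finset ι) {κ : Type*} [DecidableEq κ]
    (y : ι → κ → ℝ) (K : Finset κ) :
    ∃ F : Finset (Finset ι), (∀ a : κ → ℝ, W.filter (fun i => ∀ k ∈ K, a k ≤ y i k) ∈ F) ∧
      ∫⁻ x, (maxS F x : ℝ≥0∞) ^ 2 ∂(Measure.pi fun _ : ι => μ) ≤
        4 ^ K.card * ENNReal.ofReal (W.card * σ ^ 2) := by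
  classical
  have hint : Integrable (fun t : ℝ => t) μ := hL.integrable (by norm_num)
  have hfin : ∫⁻ x, ((∑ i, ‖x i‖₊ : ℝ≥0) : ℝ≥0∞) ^ 2 ∂(Measure.pi fun _ : ι => μ) ≠ ⊤ := by
    have hS : MemLp (fun x : ι → ℝ => ∑ i, ‖x i‖) 2 (Measure.pi fun _ : ι => μ) :=
      memLp_finsetSum _ fun i _ =>
        (hL.comp_measurePreserving (measurePreserving_eval (fun _ : ι => μ) i)).norm
    have h := hS.eLpNorm_lt_top
    rw [eLpNorm_lt_top_iff_lintegral_rpow_enorm_lt_top (by norm_num) (by norm_num)] at h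
    refine (lt_of_le_of_lt (le_of_eq (lintegral_congr fun x => ?_)) h).ne
    have : ‖∑ i, ‖x i‖‖₊ = ∑ i, ‖x i‖₊ := by
      ext
      push_cast
      rw [Real.norm_of_nonneg (Finset.sum_nonneg fun i _ => norm_nonneg _)]
    simp only [ENNReal.toReal_ofNat, ENNReal.rpow_ofNat]
    rw [← this]
    rfl
  suffices h : ∫⁻ x, (maxS (Finset.univ.filter fun C : Finset ι => ∃ a : κ → ℝ,
      C = W.filter (fun i => ∀ k ∈ K, a k ≤ y i k)) x : ℝ≥0∞) ^ 2
      ∂(Measure.pi fun _ : ι => μ) ≤ 4 ^ K.card * ENNReal.ofReal (W.card * σ ^ 2) by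
    refine ⟨_, fun a => ?_, h⟩
    simp only [Finset.mem_filter, Finset.mem_univ, true_and]
    exact ⟨a, rfl⟩
  induction K using Finset.induction_on with
  | empty =>
    rw [← base_second_moment μ σ hmean hvar hL W]
    simp [maxS, Finset.filter_eq']
  | insert k K hk ih =>
    rw [Finset.card_insert_of_notMem hk, pow_succ', mul_assoc]
    refine (doob_step μ hint hmean hfin _ _ (fun i => y i k) ?_).trans (mul_le_mul_right ih 4)
    intro C' hC'
    obtain ⟨a, rfl⟩ := (Finset.mem_filter.1 hC').2
    refine ⟨_, Finset.mem_filter.2 ⟨Finset.mem_univ _, a, rfl⟩, a k, ?_⟩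
    ext i
    simp only [Finset.mem_filter, Finset.mem_insert, forall_eq_or_imp]
    tauto

lemma max_ineq {ι : Type*} [Fintype ι] {d : ℕ} (μ : Measure ℝ)
    [IsProbabilityMeasure μ] (σ : ℝ) (hmean : ∫ x, x ∂μ = 0) (hvar : ∫ x, x ^ 2 ∂μ = σ ^ 2)
    (hL : MemLp (fun t : ℝ => t) 2 μ) (W : Finset ι)
    (y : ι → Fin d → ℝ) (t : ℝ) (ht : 0 < t) :
    (Measure.pi fun _ : ι => μ) {x | ∃ a : Fin d → ℝ,
      t < |∑ i ∈ W.filter (fun i => ∀ k, a k ≤ y i k), x i|} ≤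
        ENNReal.ofReal (4 ^ d * σ ^ 2 / t ^ 2) * W.card := by
  classical
  obtain ⟨F, hF, hI⟩ := max_second_moment μ σ hmean hvar hL W y Finset.univ
  simp only [Finset.mem_univ, forall_true_left, Finset.card_univ, Fintype.card_fin] at hF hI
  have hsub : {x : ι → ℝ | ∃ a : Fin d → ℝ,
      t < |∑ i ∈ W.filter (fun i => ∀ k, a k ≤ y i k), x i|} ⊆
      {x | ENNReal.ofReal (t ^ 2) ≤ (maxS F x : ℝ≥0∞) ^ 2} := by
    rintro x ⟨a, ha⟩
    have h1 : ‖∑ i ∈ W.filter (fun i => ∀ k, a k ≤ y i k), x i‖₊ ≤ maxS F x :=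
      Finset.le_sup (f := fun C => ‖∑ i ∈ C, x i‖₊) (hF a)
    have h2 : t ≤ maxS F x := by
      have : (‖∑ i ∈ W.filter (fun i => ∀ k, a k ≤ y i k), x i‖₊ : ℝ) ≤ maxS F x := by
        exact_mod_cast h1
      rw [coe_nnnorm, Real.norm_eq_abs] at this
      linarith
    simp only [Set.mem_ofPred_eq]
    rw [ENNReal.ofReal_pow ht.le]
    gcongr
    exact ENNReal.ofReal_le_of_le_toReal (by simpa using h2)
  refine (measure_mono hsub).trans ?_
  have ms := measurable_maxS F
  refine (meas_ge_le_lintegral_div (by fun_prop) (by simp; positivity) (by simp)).trans ?_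
  refine (ENNReal.div_le_div_right hI _).trans (le_of_eq ?_)
  have h4 : (4 : ℝ≥0∞) ^ d = ENNReal.ofReal (4 ^ d) := by
    rw [ENNReal.ofReal_pow (by norm_num)]; simp
  rw [h4, ← ENNReal.ofReal_mul (by positivity), ← ENNReal.ofReal_div_of_pos (by positivity),
    ← ENNReal.ofReal_natCast, ← ENNReal.ofReal_mul (by positivity)]
  congr 1
  ring

/-- exceedance event for the numerators -/
def evG {d n : ℕ} (U : Set (Fin d → ℝ)) [DecidablePred (· ∈ U)] (t : ℝ) :
    Set ((Fin n → Fin d → ℝ) × (Fin n → ℝ)) :=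
  {z | ∃ p : Fin d → Fin n,
    t < |∑ i, if (z.1 i ∈ U ∧ ∀ k, z.1 (p k) k ≤ z.1 i k) then z.2 i else 0|}

lemma measure_evG {d n : ℕ} (Pd : Measure (Fin d → ℝ)) [IsProbabilityMeasure Pd]
    (μ : Measure ℝ) [IsProbabilityMeasure μ] (σ : ℝ) (hmean : ∫ x, x ∂μ = 0)
    (hvar : ∫ x, x ^ 2 ∂μ = σ ^ 2) (hL : MemLp (fun t : ℝ => t) 2 μ)
    (U : Set (Fin d → ℝ)) [DecidablePred (· ∈ U)] (hU : MeasurableSet U) (t : ℝ) (ht : 0 < t) :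
    ((Measure.pi fun _ : Fin n => Pd).prod (Measure.pi fun _ : Fin n => μ)) (evG U t) ≤
      ENNReal.ofReal (4 ^ d * σ ^ 2 / t ^ 2) * (n * Pd U) := by
  have hmeas : MeasurableSet (evG (n := n) U t) := by
    have : evG (n := n) U t = ⋃ p : Fin d → Fin n, {z |
      t < |∑ i, if (z.1 i ∈ U ∧ ∀ k, z.1 (p k) k ≤ z.1 i k) then z.2 i else 0|} := by
      ext z; simp [evG]
    rw [this]
    refine MeasurableSet.iUnion fun p => ?_
    refine measurableSet_lt measurable_const ?_
    refine Measurable.abs ?_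
    refine Finset.measurable_sum _ fun i _ => ?_
    refine Measurable.ite ?_ (by fun_prop) measurable_const
    have hA : MeasurableSet ({z : (Fin n → Fin d → ℝ) × (Fin n → ℝ) | z.1 i ∈ U} ∩
        ⋂ k : Fin d, {z | z.1 (p k) k ≤ z.1 i k}) := by
      refine MeasurableSet.inter ?_ ?_
      · exact hU.preimage (f := fun z : (Fin n → Fin d → ℝ) × (Fin n → ℝ) => z.1 i) (by fun_prop)
      · exact MeasurableSet.iInter fun k => measurableSet_le (by fun_prop) (by fun_prop)
    convert hA using 1
    ext z
    simp
  rw [Measure.prod_apply hmeas]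
  have hslice : ∀ x : Fin n → Fin d → ℝ, (Measure.pi fun _ : Fin n => μ) (Prod.mk x ⁻¹' evG U t) ≤
      ENNReal.ofReal (4 ^ d * σ ^ 2 / t ^ 2) * ∑ i, (U.indicator (fun _ => (1 : ℝ≥0∞)) (x i)) := by
    intro x
    have h := max_ineq μ σ hmean hvar hL (Finset.univ.filter fun i => x i ∈ U) x t ht
    have hc : ((Finset.univ.filter fun i => x i ∈ U).card : ℝ≥0∞) =
        ∑ i, (U.indicator (fun _ => (1 : ℝ≥0∞)) (x i)) := by
      simp [Set.indicator_apply]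
    rw [← hc]
    refine (measure_mono ?_).trans h
    rintro ξ ⟨p, hp⟩
    refine ⟨fun k => x (p k) k, ?_⟩
    rw [Finset.filter_filter, Finset.sum_filter]
    exact hp
  refine (lintegral_mono hslice).trans ?_
  have hmi : ∀ i : Fin n, Measurable fun x : Fin n → Fin d → ℝ =>
      U.indicator (fun _ => (1 : ℝ≥0∞)) (x i) := fun i =>
    (measurable_const.indicator hU).comp (measurable_pi_apply i)
  rw [lintegral_const_mul _ (Finset.measurable_sum _ fun i _ => hmi i),
    lintegral_finsetSum _ fun i _ => hmi i]
  gcongr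
  have : ∀ i : Fin n, ∫⁻ x : Fin n → Fin d → ℝ, U.indicator (fun _ => (1 : ℝ≥0∞)) (x i)
      ∂(Measure.pi fun _ : Fin n => Pd) = Pd U := by
    intro i
    rw [(measurePreserving_eval (fun _ : Fin n => Pd) i).lintegral_comp
      (f := U.indicator (fun _ => (1 : ℝ≥0∞))) (measurable_const.indicator hU)]
    simp [hU]
  simp [this]

lemma count_cheb {d n : ℕ} (Pd : Measure (Fin d → ℝ)) [IsProbabilityMeasure Pd]
    (L : Set (Fin d → ℝ)) (hL : MeasurableSet L) (q : ℝ) (hq : 0 < q) (hqL : q ≤ Pd.real L)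
    (hn : 0 < n) :
    (Measure.pi fun _ : Fin n => Pd) {x | ∑ i, L.indicator (fun _ => (1 : ℝ)) (x i) < n * q / 2}
      ≤ ENNReal.ofReal (4 / (n * q)) := by
  set p := Pd.real L with hp
  have hp0 : 0 < p := hq.trans_le hqL
  have hn' : (0 : ℝ) < n := by exact_mod_cast hn
  have hm : Measurable (L.indicator fun _ => (1 : ℝ)) := measurable_const.indicator hL
  have hX : MemLp (L.indicator fun _ => (1 : ℝ)) 2 Pd :=
    memLp_indicator_const 2 hL 1 (Or.inr (measure_ne_top _ _))
  have h := ProbabilityTheory.variance_sum_pi (μ := fun _ : Fin n => Pd)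
    (X := fun _ => L.indicator fun _ => (1 : ℝ)) (fun _ => hX)
  have hv : ProbabilityTheory.variance (L.indicator fun _ => (1 : ℝ)) Pd ≤ p := by
    refine (ProbabilityTheory.variance_le_expectation_sq hm.aestronglyMeasurable).trans ?_
    have : (L.indicator fun _ => (1 : ℝ)) ^ 2 = L.indicator fun _ => (1 : ℝ) := by
      funext x; by_cases hx : x ∈ L <;> simp [hx]
    rw [this, integral_indicator_const _ hL]
    simp [hp]
  have hfun : (∑ i : Fin n, fun x : Fin n → Fin d → ℝ => L.indicator (fun _ => (1 : ℝ)) (x i)) =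
      fun x => ∑ i, L.indicator (fun _ => (1 : ℝ)) (x i) := by
    funext x; simp
  rw [hfun] at h
  have hXi : ∀ i : Fin n, MemLp (fun x : Fin n → Fin d → ℝ => L.indicator (fun _ => (1 : ℝ)) (x i))
      2 (Measure.pi fun _ : Fin n => Pd) := fun i =>
    hX.comp_measurePreserving (measurePreserving_eval (fun _ : Fin n => Pd) i)
  have hS : MemLp (fun x : Fin n → Fin d → ℝ => ∑ i, L.indicator (fun _ => (1 : ℝ)) (x i))
      2 (Measure.pi fun _ : Fin n => Pd) := memLp_finsetSum _ fun i _ => hXi i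
  have hE : ∫ x : Fin n → Fin d → ℝ, ∑ i, L.indicator (fun _ => (1 : ℝ)) (x i)
      ∂(Measure.pi fun _ : Fin n => Pd) = n * p := by
    rw [integral_finsetSum _ fun i _ => (hXi i).integrable (by norm_num)]
    have : ∀ i : Fin n, ∫ x : Fin n → Fin d → ℝ, L.indicator (fun _ => (1 : ℝ)) (x i)
      ∂(Measure.pi fun _ : Fin n => Pd) = p := by
      intro i
      rw [integral_comp_eval (μ := fun _ : Fin n => Pd) (i := i)
        (f := L.indicator (fun _ => (1 : ℝ))) hm.aestronglyMeasurable,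
        integral_indicator_const _ hL]
      simp [hp]
    simp [this]
  have hc := ProbabilityTheory.meas_ge_le_variance_div_sq hS (c := n * p / 2) (by positivity)
  rw [hE, h] at hc
  refine (measure_mono ?_).trans (hc.trans (ENNReal.ofReal_le_ofReal ?_))
  · intro x hx
    simp only [Set.mem_ofPred_eq] at hx ⊢
    rw [abs_sub_comm]
    refine le_trans ?_ (le_abs_self _)
    nlinarith
  · have h1 : ∑ i : Fin n, ProbabilityTheory.variance (L.indicator fun _ => (1 : ℝ)) Pd ≤ n * p := by
      simp only [Finset.sum_const, Finset.card_univ, Fintype.card_fin, nsmul_eq_mul]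
      gcongr
    calc _ ≤ (n * p) / (n * p / 2) ^ 2 := by gcongr
      _ = 4 / (n * p) := by field_simp; norm_num
      _ ≤ _ := by gcongr

end MaxIneq2

section Geometry

open scoped NNReal ENNReal

lemma tsum_half (d : ℕ) : ∑' j : Fin d → ℕ, ∏ k, (2⁻¹ : ℝ≥0∞) ^ (j k) ≤ 2 ^ d := by
  classical
  rw [ENNReal.tsum_eq_iSup_sum]
  refine iSup_le fun s => ?_
  obtain ⟨J, hJ⟩ : ∃ J : ℕ, ∀ j ∈ s, ∀ k, j k < J := by
    refine ⟨s.sup (fun j => Finset.univ.sup j) + 1, fun j hj k => ?_⟩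
    have h1 : j k ≤ Finset.univ.sup j := Finset.le_sup (f := j) (Finset.mem_univ k)
    have h2 : Finset.univ.sup j ≤ s.sup (fun j => Finset.univ.sup j) :=
      Finset.le_sup (f := fun j : Fin d → ℕ => Finset.univ.sup j) hj
    omega
  calc ∑ j ∈ s, ∏ k, (2⁻¹ : ℝ≥0∞) ^ (j k)
      ≤ ∑ j ∈ Fintype.piFinset (fun _ : Fin d => Finset.range J), ∏ k, (2⁻¹ : ℝ≥0∞) ^ (j k) := by
        refine Finset.sum_le_sum_of_subset fun j hj => ?_
        rw [Fintype.mem_piFinset]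
        exact fun k => Finset.mem_range.2 (hJ j hj k)
    _ = ∏ k : Fin d, ∑ m ∈ Finset.range J, (2⁻¹ : ℝ≥0∞) ^ m := by
        rw [Finset.prod_univ_sum]
    _ ≤ ∏ k : Fin d, (2 : ℝ≥0∞) := by
        refine Finset.prod_le_prod' fun k _ => ?_
        refine (ENNReal.sum_le_tsum _).trans ?_
        rw [ENNReal.tsum_geometric, ENNReal.one_sub_inv_two, inv_inv]
    _ = 2 ^ d := by simp

lemma density_bounds {d : ℕ} (Pd : Measure (Fin d → ℝ)) (π : (Fin d → ℝ) → ℝ)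
    (hPd : Pd = MeasureTheory.volume.withDensity (fun x => ENNReal.ofReal (π x)))
    (hπ0 : ∀ x, x ∉ Set.Icc (0 : Fin d → ℝ) 1 → π x = 0) (c₁ c₂ : ℝ) (hc₂ : 0 < c₂)
    (hb : ∀ x ∈ Set.Icc (0 : Fin d → ℝ) 1, c₁ ≤ π x ∧ π x ≤ c₂) :
    (∀ S, MeasurableSet S → S ⊆ Set.Icc 0 1 → ENNReal.ofReal c₁ * volume S ≤ Pd S) ∧
    (∀ S, MeasurableSet S → Pd S ≤ ENNReal.ofReal c₂ * volume S) ∧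
    Pd (Set.Icc 0 1)ᶜ = 0 := by
  subst hPd
  refine ⟨fun S hS hsub => ?_, fun S hS => ?_, ?_⟩
  · rw [withDensity_apply _ hS, ← setLIntegral_const]
    refine setLIntegral_mono' hS fun x hx => ENNReal.ofReal_le_ofReal (hb x (hsub hx)).1
  · rw [withDensity_apply _ hS, ← setLIntegral_const]
    refine setLIntegral_mono' hS fun x hx => ENNReal.ofReal_le_ofReal ?_
    by_cases h : x ∈ Set.Icc (0 : Fin d → ℝ) 1
    · exact (hb x h).2
    · rw [hπ0 x h]; exact hc₂.le
  · rw [withDensity_apply _ measurableSet_Icc.compl]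
    rw [setLIntegral_congr_fun (g := fun _ => 0) measurableSet_Icc.compl]
    · simp
    · intro x hx
      simp [hπ0 x hx]

/-- lower corner of the dyadic box -/
def lo {d : ℕ} (x₀ r : Fin d → ℝ) (τ : ℝ) (j : Fin d → ℕ) : Fin d → ℝ :=
  fun k => x₀ k - (2 ^ (j k) - 1) * τ * r k

lemma block_bound {d n : ℕ} (x₀ r : Fin d → ℝ) (τ : ℝ) (hτ : 0 < τ) (hr : ∀ k, 0 < r k)
    (hx₀ : ∀ k, 0 < x₀ k) (B : ℝ) (q : (Fin d → ℕ) → ℝ) (hq : ∀ j, 0 < q j) (hB : 0 ≤ B)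
    (u : Fin d → ℝ) [∀ j, DecidablePred (· ∈ Set.Icc (lo x₀ r τ j) u)]
    (x : Fin n → Fin d → ℝ) (ξ : Fin n → ℝ)
    (hx : ∀ i, x i ∈ Set.Icc (0 : Fin d → ℝ) 1)
    (h1 : ∀ j : Fin d → ℕ, (∀ k, (2 ^ (j k) - 1) * τ * r k ≤ x₀ k) →
      q j ≤ ∑ i, (Set.Icc (lo x₀ r τ j) u).indicator (fun _ => (1 : ℝ)) (x i))
    (h2 : ∀ j : Fin d → ℕ, (∀ k, (2 ^ (j k) - 1) * τ * r k ≤ x₀ k) →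
      (x, ξ) ∉ evG (Set.Icc (lo x₀ r τ (fun k => j k + 1)) u) (B * q j))
    (h : Fin d → ℝ) (hh : ∀ k, 0 ≤ h k) :
    |blockAvg x ξ (fun k => x₀ k - h k * r k) u| ≤ B := by
  classical
  have hj : ∀ k, ∃ m : ℕ, (2 : ℝ) ^ m ≤ 1 + min (h k) (x₀ k / r k) / τ ∧
      1 + min (h k) (x₀ k / r k) / τ < 2 ^ (m + 1) := by
    intro k
    refine exists_nat_pow_near ?_ (by norm_num)
    have : 0 ≤ min (h k) (x₀ k / r k) := le_min (hh k) (div_nonneg (hx₀ k).le (hr k).le)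
    have : 0 ≤ min (h k) (x₀ k / r k) / τ := div_nonneg this hτ.le
    linarith
  choose j hj1 hj2 using hj
  have e1 : ∀ k, (2 ^ (j k) - 1) * τ * r k ≤ min (h k) (x₀ k / r k) * r k := by
    intro k
    have : (2 ^ (j k) - 1 : ℝ) * τ ≤ min (h k) (x₀ k / r k) := by
      rw [← le_div_iff₀ hτ]; linarith [hj1 k]
    exact mul_le_mul_of_nonneg_right this (hr k).le
  have e2 : ∀ k, min (h k) (x₀ k / r k) * r k ≤ (2 ^ (j k + 1) - 1) * τ * r k := by
    intro k
    have : min (h k) (x₀ k / r k) ≤ (2 ^ (j k + 1) - 1 : ℝ) * τ := by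
      rw [← div_le_iff₀ hτ]; linarith [hj2 k]
    exact mul_le_mul_of_nonneg_right this (hr k).le
  have e3 : ∀ k, min (h k) (x₀ k / r k) * r k = min (h k * r k) (x₀ k) := by
    intro k
    rw [min_mul_of_nonneg _ _ (hr k).le, div_mul_cancel₀ _ (hr k).ne']
  have good : ∀ k, (2 ^ (j k) - 1) * τ * r k ≤ x₀ k := fun k =>
    (e1 k).trans ((e3 k).le.trans (min_le_right _ _))
  set S := Finset.univ.filter (fun i => x i ∈ Set.Icc (fun k => x₀ k - h k * r k) u) with hS
  have hcard : q j ≤ S.card := by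
    refine (h1 j good).trans ?_
    rw [Finset.card_eq_sum_ones, hS, Finset.sum_filter]
    push_cast
    refine Finset.sum_le_sum fun i _ => ?_
    by_cases hi : x i ∈ Set.Icc (lo x₀ r τ j) u
    · rw [Set.indicator_of_mem hi, if_pos]
      refine ⟨fun k => ?_, hi.2⟩
      have a1 := hi.1 k
      have a2 := (e1 k).trans ((e3 k).le.trans (min_le_left _ _))
      simp only [lo] at a1
      simp only
      linarith
    · rw [Set.indicator_of_notMem hi]; split_ifs <;> simp
  have hne : S.Nonempty := by
    rw [← Finset.card_pos]
    have := (hq j).trans_le hcard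
    exact_mod_cast this
  have hp : ∀ k, ∃ i ∈ S, ∀ i' ∈ S, x i k ≤ x i' k := fun k =>
    Finset.exists_min_image S (fun i => x i k) hne
  choose p hpS hpmin using hp
  have hsum : |∑ i ∈ S, ξ i| ≤ B * q j := by
    by_contra hcon
    refine h2 j good ⟨p, ?_⟩
    rw [not_le] at hcon
    rw [← Finset.sum_filter]
    refine lt_of_lt_of_eq hcon ?_
    congr 1
    refine (Finset.sum_congr ?_ fun _ _ => rfl).symm
    ext i
    simp only [Finset.mem_filter, Finset.mem_univ, true_and]
    constructor
    · rintro ⟨hi, hik⟩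
      rw [hS]
      refine Finset.mem_filter.2 ⟨Finset.mem_univ _, fun k => ?_, hi.2⟩
      have := (Finset.mem_filter.1 (hpS k)).2.1 k
      exact this.trans (hik k)
    · intro hi
      refine ⟨?_, fun k => hpmin k i hi⟩
      have hi' := (Finset.mem_filter.1 hi).2
      refine ⟨fun k => ?_, hi'.2⟩
      have a1 := hi'.1 k
      have a2 := (hx i).1 k
      have a3 := e2 k
      rw [e3 k] at a3
      simp only [lo]
      simp only [Pi.zero_apply] at a1 a2
      rcases min_choice (h k * r k) (x₀ k) with hmn | hmn <;> rw [hmn] at a3 <;> linarith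
  have hpos : (0 : ℝ) < S.card := (hq j).trans_le hcard
  have hav : blockAvg x ξ (fun k => x₀ k - h k * r k) u = (∑ i ∈ S, ξ i) / S.card := by
    unfold blockAvg
    simp only [hS]
    congr!
  rw [hav, abs_div, abs_of_pos hpos, div_le_iff₀ hpos]
  exact hsum.trans (mul_le_mul_of_nonneg_left hcard hB)

end Geometry

section Final

open scoped NNReal ENNReal

lemma perN {d n : ℕ} (hn : 0 < n) (x₀ r : Fin d → ℝ) (τ σ ω M c₁ c₂ : ℝ) (hτ : 0 < τ)
    (hω : 0 < ω) (hM : 0 < M) (hc₁ : 0 < c₁) (hc₂ : 0 < c₂) (hr : ∀ k, 0 < r k)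
    (hx₀ : ∀ k, 0 < x₀ k) (hr1 : ∀ k, x₀ k + τ * r k ≤ 1) (hnR : n * ∏ k, r k = (ω ^ 2)⁻¹)
    (Pd : Measure (Fin d → ℝ)) [IsProbabilityMeasure Pd]
    (hlow : ∀ S, MeasurableSet S → S ⊆ Set.Icc 0 1 → ENNReal.ofReal c₁ * volume S ≤ Pd S)
    (hup : ∀ S, MeasurableSet S → Pd S ≤ ENNReal.ofReal c₂ * volume S)
    (hsupp : Pd (Set.Icc 0 1)ᶜ = 0)
    (μ : Measure ℝ) [IsProbabilityMeasure μ] (hmean : ∫ x, x ∂μ = 0)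
    (hvar : ∫ x, x ^ 2 ∂μ = σ ^ 2) (hL : MemLp (fun t : ℝ => t) 2 μ) :
    ((Measure.pi fun _ : Fin n => Pd).prod (Measure.pi fun _ : Fin n => μ))
      {z | M * ω < |sSup {y : ℝ | ∃ h : Fin d → ℝ, (∀ k, 0 ≤ h k) ∧
        y = |blockAvg z.1 z.2 (fun k => x₀ k - h k * r k) (fun k => x₀ k + τ * r k)|}|} ≤
      ENNReal.ofReal (4 * ω ^ 2 / (c₁ * τ ^ d) +
        4 * 8 ^ d * σ ^ 2 * c₂ / (c₁ ^ 2 * M ^ 2 * τ ^ d)) * 2 ^ d := by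
  classical
  set Q := (Measure.pi fun _ : Fin n => Pd).prod (Measure.pi fun _ : Fin n => μ) with hQ
  set u : Fin d → ℝ := fun k => x₀ k + τ * r k with hu
  have hn' : (0 : ℝ) < n := by exact_mod_cast hn
  set v : (Fin d → ℕ) → ℝ := fun j => ∏ k, (2 ^ (j k) * τ * r k) with hv
  have hv0 : ∀ j, 0 < v j := fun j => Finset.prod_pos fun k _ => by have := hr k; positivity
  have hA0 : ∀ j : Fin d → ℕ, (0 : ℝ) < ∏ k, (2 : ℝ) ^ (j k) := fun j =>
    Finset.prod_pos fun k _ => by positivity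
  have hnv : ∀ j, n * v j = (∏ k, (2 : ℝ) ^ (j k)) * τ ^ d / ω ^ 2 := by
    intro j
    simp only [hv, Finset.prod_mul_distrib, Finset.prod_const, Finset.card_univ, Fintype.card_fin]
    rw [div_eq_mul_inv, ← hnR]; ring
  have hvol : ∀ j, volume (Set.Icc (lo x₀ r τ j) u) = ENNReal.ofReal (v j) := by
    intro j
    rw [Real.volume_Icc_pi, hv, ENNReal.ofReal_prod_of_nonneg]
    · refine Finset.prod_congr rfl fun k _ => ?_
      congr 1
      simp only [lo, hu]; ring
    · intro k _; have := hr k; positivity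
  set good : (Fin d → ℕ) → Prop := fun j => ∀ k, (2 ^ (j k) - 1) * τ * r k ≤ x₀ k with hgood
  set q : (Fin d → ℕ) → ℝ := fun j => n * (c₁ * v j) / 2 with hq
  have hq0 : ∀ j, 0 < q j := fun j => by have := hv0 j; simp only [hq]; positivity
  set E0 : Set ((Fin n → Fin d → ℝ) × (Fin n → ℝ)) :=
    ⋃ i : Fin n, {z | z.1 i ∈ (Set.Icc (0 : Fin d → ℝ) 1)ᶜ} with hE0
  set E1 : (Fin d → ℕ) → Set ((Fin n → Fin d → ℝ) × (Fin n → ℝ)) := fun j =>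
    {z | good j ∧ ∑ i, (Set.Icc (lo x₀ r τ j) u).indicator (fun _ => (1 : ℝ)) (z.1 i) < q j}
    with hE1
  set E2 : (Fin d → ℕ) → Set ((Fin n → Fin d → ℝ) × (Fin n → ℝ)) := fun j =>
    {z | z ∈ evG (Set.Icc (lo x₀ r τ (fun k => j k + 1)) u) (M * ω * q j)} with hE2
  have hfst : ∀ S : Set (Fin n → Fin d → ℝ), Q {z | z.1 ∈ S} =
      (Measure.pi fun _ : Fin n => Pd) S := by
    intro S
    have : {z : (Fin n → Fin d → ℝ) × (Fin n → ℝ) | z.1 ∈ S} = S ×ˢ Set.univ := by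
      ext z; simp
    rw [this, hQ, Measure.prod_prod]; simp
  have hsub : {z : (Fin n → Fin d → ℝ) × (Fin n → ℝ) |
      M * ω < |sSup {y : ℝ | ∃ h : Fin d → ℝ, (∀ k, 0 ≤ h k) ∧
        y = |blockAvg z.1 z.2 (fun k => x₀ k - h k * r k) u|}|} ⊆
      E0 ∪ ⋃ j, (E1 j ∪ E2 j) := by
    intro z hz
    have hz' := hz
    rw [Set.mem_ofPred_eq] at hz'
    by_contra hcon
    simp only [Set.mem_union, Set.mem_iUnion, not_or, not_exists] at hcon
    obtain ⟨hc0, hc12⟩ := hcon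
    refine absurd hz' (not_lt.2 ?_)
    have hx : ∀ i, z.1 i ∈ Set.Icc (0 : Fin d → ℝ) 1 := by
      intro i
      by_contra hi
      exact hc0 (Set.mem_iUnion.2 ⟨i, hi⟩)
    have hB : 0 ≤ M * ω := by positivity
    have hbb := block_bound x₀ r τ hτ hr hx₀ (M * ω) q hq0 hB u z.1 z.2 hx
      (fun j hj => not_lt.1 fun hlt => (hc12 j).1 ⟨hj, hlt⟩) (fun j _ => (hc12 j).2)
    rw [abs_of_nonneg (Real.sSup_nonneg (by rintro y ⟨h, _, rfl⟩; exact abs_nonneg _))]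
    refine Real.sSup_le ?_ hB
    rintro y ⟨h, hh, rfl⟩
    exact hbb h hh
  have b0 : Q E0 = 0 := by
    rw [hE0, measure_iUnion_null_iff]
    intro i
    refine (hfst {x | x i ∈ (Set.Icc (0 : Fin d → ℝ) 1)ᶜ}).trans ?_
    have := (measurePreserving_eval (fun _ : Fin n => Pd) i).measure_preimage
      (s := (Set.Icc (0 : Fin d → ℝ) 1)ᶜ) measurableSet_Icc.compl.nullMeasurableSet
    rw [hsupp] at this
    exact this
  have b1 : ∀ j, Q (E1 j) ≤
      ENNReal.ofReal (4 * ω ^ 2 / (c₁ * τ ^ d) * (∏ k, (2 : ℝ) ^ (j k))⁻¹) := by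
    intro j
    by_cases hg : good j
    · have hsubI : Set.Icc (lo x₀ r τ j) u ⊆ Set.Icc 0 1 := by
        refine Set.Icc_subset_Icc (fun k => ?_) (fun k => hr1 k)
        have := hg k
        simp only [lo, Pi.zero_apply]; linarith
      have hPL : c₁ * v j ≤ Pd.real (Set.Icc (lo x₀ r τ j) u) := by
        have := hlow _ measurableSet_Icc hsubI
        rw [hvol, ← ENNReal.ofReal_mul hc₁.le] at this
        exact (ENNReal.ofReal_le_iff_le_toReal (measure_ne_top _ _)).1 this
      have h := count_cheb (n := n) Pd (Set.Icc (lo x₀ r τ j) u) measurableSet_Icc (c₁ * v j)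
        (mul_pos hc₁ (hv0 j)) hPL hn
      rw [← hfst] at h
      refine (measure_mono ?_).trans (h.trans (ENNReal.ofReal_le_ofReal (le_of_eq ?_)))
      · rintro z ⟨_, hz⟩; exact hz
      · have e : (n : ℝ) * (c₁ * v j) = c₁ * ((∏ k, (2 : ℝ) ^ (j k)) * τ ^ d / ω ^ 2) := by
          rw [← hnv]; ring
        rw [e]
        have := hA0 j
        field_simp
    · have : E1 j = ∅ := by
        ext z; simp [hE1, hg]
      rw [this]; simp
  have b2 : ∀ j, Q (E2 j) ≤
      ENNReal.ofReal (4 * 8 ^ d * σ ^ 2 * c₂ / (c₁ ^ 2 * M ^ 2 * τ ^ d) *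
        (∏ k, (2 : ℝ) ^ (j k))⁻¹) := by
    intro j
    have hq0j := hq0 j
    have h := measure_evG (n := n) Pd μ σ hmean hvar hL
      (Set.Icc (lo x₀ r τ (fun k => j k + 1)) u) measurableSet_Icc (M * ω * q j) (by positivity)
    refine h.trans ?_
    have hU := hup (Set.Icc (lo x₀ r τ (fun k => j k + 1)) u) measurableSet_Icc
    have hv1 : v (fun k => j k + 1) = 2 ^ d * v j := by
      simp only [hv, pow_succ, Finset.prod_mul_distrib, Finset.prod_const, Finset.card_univ,
        Fintype.card_fin]
      ring
    rw [hvol, hv1, ← ENNReal.ofReal_mul hc₂.le] at hU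
    have hvj := hv0 j
    refine (mul_le_mul_right (mul_le_mul_right hU _) _).trans (le_of_eq ?_)
    rw [← ENNReal.ofReal_natCast, ← ENNReal.ofReal_mul (by positivity),
      ← ENNReal.ofReal_mul (by positivity)]
    congr 1
    have e : q j = c₁ / 2 * ((∏ k, (2 : ℝ) ^ (j k)) * τ ^ d / ω ^ 2) := by
      rw [← hnv]; simp only [hq]; ring
    have e2 : (n : ℝ) * (c₂ * (2 ^ d * v j)) =
        c₂ * 2 ^ d * ((∏ k, (2 : ℝ) ^ (j k)) * τ ^ d / ω ^ 2) := by
      rw [← hnv]; ring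
    rw [e, e2]
    have := hA0 j
    have e8 : (8 : ℝ) ^ d = 4 ^ d * 2 ^ d := by rw [← mul_pow]; norm_num
    rw [e8]
    field_simp
    ring
  have K0 : 0 ≤ 4 * ω ^ 2 / (c₁ * τ ^ d) := by positivity
  have K1 : 0 ≤ 4 * 8 ^ d * σ ^ 2 * c₂ / (c₁ ^ 2 * M ^ 2 * τ ^ d) := by positivity
  have hinv : ∀ j : Fin d → ℕ, ENNReal.ofReal ((∏ k, (2 : ℝ) ^ (j k))⁻¹) =
      ∏ k, (2⁻¹ : ℝ≥0∞) ^ (j k) := by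
    intro j
    rw [← Finset.prod_inv_distrib, ENNReal.ofReal_prod_of_nonneg (fun k _ => by positivity)]
    refine Finset.prod_congr rfl fun k _ => ?_
    rw [← inv_pow, ENNReal.ofReal_pow (by positivity), ENNReal.ofReal_inv_of_pos (by norm_num)]
    simp
  calc Q _ ≤ Q (E0 ∪ ⋃ j, (E1 j ∪ E2 j)) := measure_mono hsub
    _ ≤ Q E0 + Q (⋃ j, (E1 j ∪ E2 j)) := measure_union_le _ _
    _ ≤ 0 + ∑' j, (Q (E1 j) + Q (E2 j)) := by
        rw [b0]
        gcongr
        exact (measure_iUnion_le _).trans (ENNReal.tsum_le_tsum fun j => measure_union_le _ _)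
    _ ≤ ∑' j : Fin d → ℕ, ENNReal.ofReal (4 * ω ^ 2 / (c₁ * τ ^ d) +
        4 * 8 ^ d * σ ^ 2 * c₂ / (c₁ ^ 2 * M ^ 2 * τ ^ d)) * ∏ k, (2⁻¹ : ℝ≥0∞) ^ (j k) := by
        rw [zero_add]
        refine ENNReal.tsum_le_tsum fun j => (add_le_add (b1 j) (b2 j)).trans (le_of_eq ?_)
        rw [ENNReal.ofReal_mul K0, ENNReal.ofReal_mul K1, ENNReal.ofReal_add K0 K1, hinv]
        ring
    _ ≤ _ := by
        rw [ENNReal.tsum_mul_left]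
        gcongr
        exact tsum_half d

end Final


/-- Lemma 2 of the paper (uniform control of the averaged noise over growing rectangles),
random design case with all smoothness indices finite:
`sup_{h ≥ 0} |ξ̄|_{[x₀−h⊙r_n, x₀+τ·r_n]}| = O_P(ω_n)`. -/
theorem stmt13 (d : ℕ) (hd : 1 ≤ d) (α : Fin d → ℕ) (hα : ∀ k, 1 ≤ α k)
    (x₀ : Fin d → ℝ) (hx₀ : ∀ k, x₀ k ∈ Set.Ioo (0 : ℝ) 1)
    (τ σ : ℝ) (hτ : 0 < τ) (hσ : 0 < σ)
    {Ω : Type*} [MeasurableSpace Ω] (P : Measure Ω) [IsProbabilityMeasure P]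
    (Pd : Measure (Fin d → ℝ)) [IsProbabilityMeasure Pd]
    (π : (Fin d → ℝ) → ℝ)
    (hPd : Pd = MeasureTheory.volume.withDensity (fun x => ENNReal.ofReal (π x)))
    (hπ0 : ∀ x, x ∉ Set.Icc (0 : Fin d → ℝ) 1 → π x = 0)
    (hπbdd : ∃ c₁ c₂ : ℝ, 0 < c₁ ∧ 0 < c₂ ∧
      ∀ x ∈ Set.Icc (0 : Fin d → ℝ) 1, c₁ ≤ π x ∧ π x ≤ c₂)
    (μ : Measure ℝ) [IsProbabilityMeasure μ]
    (hmean : ∫ x, x ∂μ = 0) (hvar : ∫ x, x ^ 2 ∂μ = σ ^ 2)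
    (hL2 : Integrable (fun x : ℝ => x ^ 2) μ)
    (X : ℕ → Ω → (Fin d → ℝ)) (ξ : ℕ → Ω → ℝ)
    (hXmeas : ∀ i, Measurable (X i)) (hξmeas : ∀ i, Measurable (ξ i))
    (hiid : ∀ n : ℕ,
      Measure.map (fun ω => fun i : Fin n => (X i ω, ξ i ω)) P =
        Measure.pi (fun _ : Fin n => Pd.prod μ)) :
    ∀ ε : ℝ, 0 < ε → ∃ M : ℝ,
      limsup (fun n : ℕ =>
        P {ω : Ω |
          M * ((n : ℝ) ^ (-(2 + ∑ k : Fin d, ((α k : ℝ))⁻¹)⁻¹)) <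
            |sSup {y : ℝ | ∃ h : Fin d → ℝ, (∀ k, 0 ≤ h k) ∧
              y = |blockAvg (fun i : Fin n => X i ω) (fun i : Fin n => ξ i ω)
                (fun k => min
                  (x₀ k - h k * (((n : ℝ) ^ (-(2 + ∑ k' : Fin d, ((α k' : ℝ))⁻¹)⁻¹)) ^ ((α k : ℝ)⁻¹)))
                  (x₀ k + τ * (((n : ℝ) ^ (-(2 + ∑ k' : Fin d, ((α k' : ℝ))⁻¹)⁻¹)) ^ ((α k : ℝ)⁻¹))))
                (fun k => max
                  (x₀ k - h k * (((n : ℝ) ^ (-(2 + ∑ k' : Fin d, ((α k' : ℝ))⁻¹)⁻¹)) ^ ((α k : ℝ)⁻¹)))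
                  (x₀ k + τ * (((n : ℝ) ^ (-(2 + ∑ k' : Fin d, ((α k' : ℝ))⁻¹)⁻¹)) ^ ((α k : ℝ)⁻¹))))|}|})
        atTop ≤ ENNReal.ofReal ε := by
  intro ε hε
  obtain ⟨c₁, c₂, hc₁, hc₂, hb⟩ := hπbdd
  obtain ⟨hlow, hup, hsupp⟩ := density_bounds Pd π hPd hπ0 c₁ c₂ hc₂ hb
  have hL : MemLp (fun t : ℝ => t) 2 μ :=
    (memLp_two_iff_integrable_sq (by fun_prop)).2 hL2
  set s : ℝ := ∑ k : Fin d, ((α k : ℝ))⁻¹ with hs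
  have hs0 : 0 ≤ s := Finset.sum_nonneg fun k _ => by positivity
  set w : ℕ → ℝ := fun n => (n : ℝ) ^ (-(2 + s)⁻¹) with hw
  have hw0 : Tendsto w atTop (nhds 0) :=
    (tendsto_rpow_neg_atTop (by positivity)).comp tendsto_natCast_atTop_atTop
  set K : ℝ := 4 * 8 ^ d * σ ^ 2 * c₂ / (c₁ ^ 2 * τ ^ d) * 2 ^ d with hK
  have hK0 : 0 < K := by positivity
  refine ⟨Real.sqrt (2 * K / ε), ?_⟩
  set M := Real.sqrt (2 * K / ε) with hM
  have hM0 : 0 < M := Real.sqrt_pos.2 (by positivity)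
  have hM2 : M ^ 2 = 2 * K / ε := Real.sq_sqrt (by positivity)
  refine limsup_le_of_le (by isBoundedDefault) ?_
  have hr0 : ∀ k : Fin d, Tendsto (fun n => x₀ k + τ * w n ^ ((α k : ℝ)⁻¹)) atTop (nhds (x₀ k)) := by
    intro k
    have hαk : (0 : ℝ) < (α k : ℝ)⁻¹ := inv_pos.2 (by exact_mod_cast hα k)
    have := (hw0.rpow_const (p := (α k : ℝ)⁻¹) (Or.inr hαk.le)).const_mul τ
    rw [Real.zero_rpow hαk.ne', mul_zero] at this
    simpa using this.const_add (x₀ k)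
  have ev1 : ∀ᶠ n in atTop, ∀ k : Fin d, x₀ k + τ * w n ^ ((α k : ℝ)⁻¹) ≤ 1 := by
    rw [eventually_all]
    intro k
    exact (hr0 k).eventually_le_const (hx₀ k).2
  have ev2 : ∀ᶠ n in atTop, 4 * w n ^ 2 / (c₁ * τ ^ d) * 2 ^ d ≤ ε / 2 := by
    have : Tendsto (fun n => 4 * w n ^ 2 / (c₁ * τ ^ d) * 2 ^ d) atTop (nhds 0) := by
      have := (((hw0.pow 2).const_mul 4).div_const (c₁ * τ ^ d)).mul_const ((2 : ℝ) ^ d)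
      simpa using this
    exact this.eventually_le_const (by positivity)
  filter_upwards [ev1, ev2, eventually_gt_atTop 0] with n h1 h2 hn
  have hn' : (0 : ℝ) < n := by exact_mod_cast hn
  have hwn : 0 < w n := Real.rpow_pos_of_pos hn' _
  set r : Fin d → ℝ := fun k => w n ^ ((α k : ℝ)⁻¹) with hr
  have hrp : ∀ k, 0 < r k := fun k => Real.rpow_pos_of_pos hwn _
  have hnR : n * ∏ k, r k = (w n ^ 2)⁻¹ := by
    have e1 : ∏ k, r k = w n ^ s := by
      rw [hs, Real.rpow_sum_of_pos hwn]
    have e2 : w n ^ (2 + s) = (n : ℝ)⁻¹ := by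
      simp only [hw]
      rw [← Real.rpow_mul hn'.le, neg_mul, inv_mul_cancel₀ (by positivity), Real.rpow_neg_one]
    rw [Real.rpow_add hwn, Real.rpow_ofNat] at e2
    rw [e1, ← mul_eq_one_iff_eq_inv₀ (by positivity), mul_assoc, mul_comm (w n ^ s), e2,
      mul_inv_cancel₀ hn'.ne']
  have hmain := perN hn x₀ r τ σ (w n) M c₁ c₂ hτ hwn hM0 hc₁ hc₂ hrp (fun k => (hx₀ k).1) h1 hnR
    Pd hlow hup hsupp μ hmean hvar hL
  have hT : Measurable (fun ω => fun i : Fin n => (X i ω, ξ i ω)) := by fun_prop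
  have hmp : MeasurePreserving (fun ω => ((fun i : Fin n => X i ω), (fun i : Fin n => ξ i ω))) P
      ((Measure.pi fun _ : Fin n => Pd).prod (Measure.pi fun _ : Fin n => μ)) :=
    (measurePreserving_arrowProdEquivProdArrow (Fin d → ℝ) ℝ (Fin n) (fun _ => Pd)
      (fun _ => μ)).comp ⟨hT, hiid n⟩
  have hbd : ENNReal.ofReal (4 * w n ^ 2 / (c₁ * τ ^ d) +
        4 * 8 ^ d * σ ^ 2 * c₂ / (c₁ ^ 2 * M ^ 2 * τ ^ d)) * 2 ^ d ≤ ENNReal.ofReal ε := by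
    have h2d : (2 : ENNReal) ^ d = ENNReal.ofReal (2 ^ d) := by
      rw [ENNReal.ofReal_pow (by norm_num)]; simp
    rw [h2d, ← ENNReal.ofReal_mul (by positivity)]
    refine ENNReal.ofReal_le_ofReal ?_
    have e : 4 * 8 ^ d * σ ^ 2 * c₂ / (c₁ ^ 2 * M ^ 2 * τ ^ d) * 2 ^ d = ε / 2 := by
      have : 4 * 8 ^ d * σ ^ 2 * c₂ / (c₁ ^ 2 * M ^ 2 * τ ^ d) * 2 ^ d = K / M ^ 2 := by
        rw [hK]; field_simp
      rw [this, hM2]; field_simp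
    rw [add_mul, e]; linarith
  refine le_trans ?_ (hmain.trans hbd)
  rw [← hmp.map_eq]
  refine le_trans (measure_mono ?_) (Measure.le_map_apply hmp.measurable.aemeasurable _)
  intro ω hω
  simp only [Set.mem_preimage, Set.mem_ofPred_eq] at hω ⊢
  convert hω using 6 with y
  funext h
  refine propext (and_congr_right fun hh => ?_)
  have hle : ∀ k, x₀ k - h k * r k ≤ x₀ k + τ * r k := fun k => by
    have := hrp k
    have := hh k
    have : 0 ≤ h k * r k := by positivity
    have : 0 ≤ τ * r k := by positivity
    linarith
  have a1 : (fun k => min (x₀ k - h k * r k) (x₀ k + τ * r k)) = fun k => x₀ k - h k * r k :=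
    funext fun k => min_eq_left (hle k)
  have a2 : (fun k => max (x₀ k - h k * r k) (x₀ k + τ * r k)) = fun k => x₀ k + τ * r k :=
    funext fun k => max_eq_right (hle k)
  rw [← a1, ← a2]
end

section
/- Let m ≥ 1, σ > 0, let α_1,…,α_m be positive odd integers and a_1,…,a_m > 0 be reals. Let (𝔾(h₁,h₂)), indexed by h₁, h₂ ∈ ℝ_{≥0}^m, be a centered Gaussian process with continuous sample paths and covariance E[𝔾(h₁,h₂)·𝔾(h₁',h₂')] = ∏_{k=1}^m ( (h₁)_k ∧ (h₁')_k + (h₂)_k ∧ (h₂')_k ). Define W = sup_{h₁ ∈ (0,∞)^m} inf_{h₂ ∈ (0,∞)^m} [ σ·𝔾(h₁,h₂) / ∏_{k=1}^m ((h₁)_k + (h₂)_k) + Σ_{k=1}^m a_k·((h₂)_k^{α_k+1} − (h₁)_k^{α_k+1}) / ((h₂)_k + (h₁)_k) ]. Then W is finite almost surely and has a sub-Gaussian tail: there exists C > 0 such that P(|W| > u) ≤ 2·exp(−u²/C) for all u > 0. -/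
open MeasureTheory ProbabilityTheory

/-- A family `G` of real random variables is a centered Gaussian process if every finite
linear combination has a centered Gaussian distribution. -/
def IsCenteredGaussianProcess {Ω T : Type*} [MeasurableSpace Ω] (P : Measure Ω)
    (G : T → Ω → ℝ) : Prop :=
  (∀ t, Measurable (G t)) ∧
    ∀ (n : ℕ) (t : Fin n → T) (c : Fin n → ℝ),
      ∃ v : NNReal,
        Measure.map (fun ω => ∑ i : Fin n, c i * G (t i) ω) P = gaussianReal 0 v

lemma aux_tail {Ω : Type*} [MeasurableSpace Ω] (P : Measure Ω) [IsProbabilityMeasure P]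
    (Z : Ω → ℝ) (hZ : Measurable Z) (v : NNReal) (h : P.map Z = gaussianReal 0 v)
    (V : ℝ) (hV : 0 < V) (hv : (v : ℝ) ≤ V) (t : ℝ) (ht : 0 ≤ t) :
    P {ω | t < |Z ω|} ≤ ENNReal.ofReal (2 * Real.exp (-t ^ 2 / (2 * V))) := by
  lift V to NNReal using hV.le
  have hs : HasSubgaussianMGF Z V P := by
    refine ⟨fun s => ?_, fun s => ?_⟩
    · have := integrable_exp_mul_gaussianReal (μ := 0) (v := v) s
      rw [← h] at this
      exact this.comp_measurable hZ
    · rw [mgf_gaussianReal h]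
      apply Real.exp_le_exp.2
      have : (v : ℝ) * s ^ 2 ≤ V * s ^ 2 := by gcongr
      linarith
  have h1 := hs.measure_ge_le ht
  have h2 := hs.neg.measure_ge_le ht
  have hsub : {ω | t < |Z ω|} ⊆ {ω | t ≤ Z ω} ∪ {ω | t ≤ (-Z) ω} := by
    intro ω hω
    simp only [Set.mem_setOf_eq] at hω
    rcases lt_abs.1 hω with h | h
    · left; exact h.le
    · right; exact h.le
  calc P {ω | t < |Z ω|} ≤ P {ω | t ≤ Z ω} + P {ω | t ≤ (-Z) ω} :=
        (measure_mono hsub).trans (measure_union_le _ _)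
    _ = ENNReal.ofReal (P.real {ω | t ≤ Z ω}) + ENNReal.ofReal (P.real {ω | t ≤ (-Z) ω}) := by
        rw [ofReal_measureReal, ofReal_measureReal]
    _ = ENNReal.ofReal (P.real {ω | t ≤ Z ω} + P.real {ω | t ≤ (-Z) ω}) := by
        rw [ENNReal.ofReal_add] <;> positivity
    _ ≤ _ := ENNReal.ofReal_le_ofReal (by linarith)

lemma aux_chain {Ω ι : Type*} [Fintype ι] [MeasurableSpace Ω] (P : Measure Ω)
    [IsProbabilityMeasure P] (Y : (ι → ℝ) → Ω → ℝ) (hmeas : ∀ s, Measurable (Y s))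
    (L : ℝ) (hL : 0 < L)
    (h0 : ∃ v : NNReal, P.map (Y 0) = gaussianReal 0 v ∧ (v : ℝ) ≤ L)
    (hinc : ∀ s s' : ι → ℝ, (∀ i, 0 ≤ s i ∧ s i < 1) → (∀ i, 0 ≤ s' i ∧ s' i < 1) →
      ∀ δ : ℝ, 0 < δ → (∀ i, |s i - s' i| ≤ δ) →
      ∃ v : NNReal, P.map (fun ω => Y s ω - Y s' ω) = gaussianReal 0 v ∧ (v : ℝ) ≤ L * δ)
    (hcont : ∀ ω, ∀ s : ι → ℝ, (∀ i, 0 ≤ s i ∧ s i < 1) →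
      ContinuousAt (fun s => Y s ω) s) :
    ∃ K : ℝ, 0 < K ∧ ∀ u : ℝ, 1 ≤ u →
      P {ω | ∃ s : ι → ℝ, (∀ i, 0 ≤ s i ∧ s i < 1) ∧ K * u < |Y s ω|} ≤
        ENNReal.ofReal (4 * Real.exp (-u ^ 2)) := by
  classical
  set D : ℝ := (Fintype.card ι : ℝ) with hD
  have hD0 : 0 ≤ D := by positivity
  set B : ℝ := Real.sqrt (2 * L * (2 * D + 2)) with hB
  have hBpos : 0 < B := Real.sqrt_pos.2 (by positivity)
  have hBsq : B ^ 2 = 2 * L * (2 * D + 2) := Real.sq_sqrt (by positivity)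
  let g : ℕ → (ι → ℕ) → ι → ℝ := fun n k i => (k i : ℝ) / 4 ^ n
  let lev : ℕ → Finset (ι → ℕ) := fun n => Fintype.piFinset (fun _ => Finset.range (4 ^ n))
  have hg : ∀ n, ∀ k ∈ lev n, ∀ i, 0 ≤ g n k i ∧ g n k i < 1 := by
    intro n k hk i
    have h1 : k i < 4 ^ n := by simpa [lev] using (Fintype.mem_piFinset.1 hk i)
    have h2 : (k i : ℝ) < 4 ^ n := by exact_mod_cast h1
    refine ⟨by positivity, ?_⟩
    simp only [g]
    rw [div_lt_one (by positivity)]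
    exact h2
  let par : (ι → ℕ) → ι → ℕ := fun k i => k i / 4
  have hpar : ∀ n, ∀ k ∈ lev (n + 1), par k ∈ lev n := by
    intro n k hk
    refine Fintype.mem_piFinset.2 fun i => ?_
    have h1 : k i < 4 ^ (n + 1) := by simpa [lev] using (Fintype.mem_piFinset.1 hk i)
    simp only [par, Finset.mem_range]
    rw [pow_succ] at h1
    omega
  have hdist : ∀ n k i, |g (n + 1) k i - g n (par k) i| ≤ 1 / 4 ^ n := by
    intro n k i
    have e : k i = 4 * (k i / 4) + k i % 4 := (Nat.div_add_mod _ _).symm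
    have hlt : k i % 4 < 4 := Nat.mod_lt _ (by norm_num)
    have e' : (k i : ℝ) = 4 * ((k i / 4 : ℕ) : ℝ) + ((k i % 4 : ℕ) : ℝ) := by exact_mod_cast e
    have hlt' : ((k i % 4 : ℕ) : ℝ) ≤ 4 := by exact_mod_cast hlt.le
    have : g (n + 1) k i - g n (par k) i = ((k i % 4 : ℕ) : ℝ) / 4 / 4 ^ n := by
      simp only [g, par]
      rw [e', pow_succ]
      field_simp
      have : (4 * (k i / 4) + k i % 4) / 4 = k i / 4 := by omega
      push_cast
      ring
    rw [this, abs_of_nonneg (by positivity)]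
    gcongr
    linarith
  refine ⟨5 * B, by positivity, fun u hu => ?_⟩
  have hu0 : 0 < u := by linarith
  let bad : ℕ → (ι → ℕ) → Set Ω := fun n k =>
    {ω | u * B * (n + 1) / 2 ^ n < |Y (g (n + 1) k) ω - Y (g n (par k)) ω|}
  let bad0 : Set Ω := {ω | u * B < |Y 0 ω|}
  have hb0 : P bad0 ≤ ENNReal.ofReal (2 * Real.exp (-u ^ 2)) := by
    obtain ⟨v, hv, hvL⟩ := h0
    refine (aux_tail P (Y 0) (hmeas 0) v hv L hL hvL (u * B) (by positivity)).trans ?_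
    apply ENNReal.ofReal_le_ofReal
    gcongr
    rw [mul_pow, hBsq, neg_div, neg_le_neg_iff, le_div_iff₀ (by positivity)]
    nlinarith [mul_nonneg (mul_nonneg (sq_nonneg u) hL.le) hD0, mul_nonneg (sq_nonneg u) hL.le]
  have hbad : ∀ n, ∀ k ∈ lev (n + 1), P (bad n k) ≤
      ENNReal.ofReal (2 * Real.exp (-(u ^ 2 * (n + 1) * (2 * D + 2)))) := by
    intro n k hk
    obtain ⟨v, hv, hvL⟩ := hinc _ _ (hg _ _ hk) (hg _ _ (hpar _ _ hk)) (1 / 4 ^ n)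
      (by positivity) (hdist n k)
    refine (aux_tail P (fun ω => Y (g (n + 1) k) ω - Y (g n (par k)) ω)
      ((hmeas _).sub (hmeas _)) v hv _ (by positivity) hvL (u * B * (n + 1) / 2 ^ n)
      (by positivity)).trans ?_
    apply ENNReal.ofReal_le_ofReal
    gcongr
    have : -(u * B * (n + 1) / 2 ^ n) ^ 2 / (2 * (L * (1 / 4 ^ n))) =
        -(u ^ 2 * (n + 1) ^ 2 * (2 * D + 2)) := by
      have h4 : (4 : ℝ) ^ n = (2 ^ n) ^ 2 := by rw [← pow_mul, mul_comm, pow_mul]; norm_num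
      rw [div_pow, mul_pow, mul_pow, hBsq, h4]
      field_simp
    rw [this, neg_le_neg_iff]
    have hn : (1 : ℝ) ≤ n + 1 := by have : (0 : ℝ) ≤ n := by positivity
                                    linarith
    have : (n + 1 : ℝ) ≤ (n + 1) ^ 2 := by nlinarith
    gcongr
  have hsum : ∀ n : ℕ, P (⋃ k ∈ lev (n + 1), bad n k) ≤
      ENNReal.ofReal (2 * Real.exp (-u ^ 2)) * (2⁻¹) ^ (n + 1) := by
    intro n
    have hc : ((lev (n + 1)).card : ℝ) ≤ Real.exp (2 * D * (n + 1)) := by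
      have h1 : (lev (n + 1)).card = (4 ^ (n + 1)) ^ Fintype.card ι := by
        simp [lev, Fintype.card_piFinset]
      have h4 : (4 : ℝ) ≤ Real.exp 2 := by
        have := Real.add_one_le_exp (1 : ℝ)
        have e : Real.exp 2 = Real.exp 1 * Real.exp 1 := by rw [← Real.exp_add]; norm_num
        nlinarith
      rw [h1]
      push_cast
      rw [← pow_mul]
      calc (4 : ℝ) ^ ((n + 1) * Fintype.card ι)
          ≤ (Real.exp 2) ^ ((n + 1) * Fintype.card ι) := by gcongr
        _ = Real.exp (2 * D * (n + 1)) := by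
          rw [← Real.exp_nat_mul]
          push_cast
          congr 1
          ring
    have he : Real.exp (-((n : ℝ) + 1)) ≤ (2⁻¹ : ℝ) ^ (n + 1) := by
      have h2 : Real.exp (-1) ≤ 2⁻¹ := by
        rw [Real.exp_neg]
        have := Real.add_one_le_exp (1 : ℝ)
        gcongr
        linarith
      calc Real.exp (-((n : ℝ) + 1)) = Real.exp (-1) ^ (n + 1) := by
            rw [← Real.exp_nat_mul]; push_cast; ring_nf
        _ ≤ _ := by gcongr
    calc P (⋃ k ∈ lev (n + 1), bad n k) ≤ ∑ k ∈ lev (n + 1), P (bad n k) :=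
          measure_biUnion_finset_le _ _
      _ ≤ ∑ k ∈ lev (n + 1), ENNReal.ofReal (2 * Real.exp (-(u ^ 2 * (n + 1) * (2 * D + 2)))) :=
          Finset.sum_le_sum (hbad n)
      _ = ENNReal.ofReal ((lev (n + 1)).card * (2 * Real.exp (-(u ^ 2 * (n + 1) * (2 * D + 2))))) := by
          rw [Finset.sum_const, nsmul_eq_mul, ENNReal.ofReal_mul (p := ((lev (n + 1)).card : ℝ)) (by positivity),
            ENNReal.ofReal_natCast]
      _ ≤ ENNReal.ofReal (2 * Real.exp (-u ^ 2) * (2⁻¹ : ℝ) ^ (n + 1)) := by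
          apply ENNReal.ofReal_le_ofReal
          calc _ ≤ Real.exp (2 * D * (n + 1)) *
                (2 * Real.exp (-(u ^ 2 * (n + 1) * (2 * D + 2)))) := by gcongr
            _ = 2 * Real.exp (2 * D * (n + 1) - u ^ 2 * (n + 1) * (2 * D + 2)) := by
              rw [sub_eq_add_neg, Real.exp_add]; ring
            _ ≤ 2 * Real.exp (-u ^ 2 + -((n : ℝ) + 1)) := by
              gcongr
              have hn : (0 : ℝ) ≤ n := by positivity
              have hu2 : 1 ≤ u ^ 2 := by nlinarith
              have a1 : 0 ≤ (u ^ 2 - 1) * ((n + 1) * (2 * D + 1)) :=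
                mul_nonneg (by linarith) (by positivity)
              have a2 : 0 ≤ u ^ 2 * n := by positivity
              nlinarith
            _ ≤ _ := by rw [Real.exp_add]; rw [← mul_assoc]; gcongr
      _ = _ := by
          rw [ENNReal.ofReal_mul (by positivity), ENNReal.ofReal_pow (by positivity)]
          congr 2
          rw [ENNReal.ofReal_inv_of_pos (by norm_num)]
          simp
  have hsub : {ω | ∃ s : ι → ℝ, (∀ i, 0 ≤ s i ∧ s i < 1) ∧ 5 * B * u < |Y s ω|} ⊆
      bad0 ∪ ⋃ n, ⋃ k ∈ lev (n + 1), bad n k := by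
    rintro ω ⟨s, hs, hlt⟩
    by_contra hcon
    simp only [Set.mem_union, Set.mem_iUnion, not_or, not_exists] at hcon
    obtain ⟨hc0, hc1⟩ := hcon
    let k : ℕ → ι → ℕ := fun n i => ⌊4 ^ n * s i⌋₊
    have hk : ∀ n, k n ∈ lev n := by
      intro n
      refine Fintype.mem_piFinset.2 fun i => ?_
      simp only [k, Finset.mem_range]
      rw [Nat.floor_lt (mul_nonneg (by positivity) (hs i).1)]
      push_cast
      have : (0 : ℝ) < 4 ^ n := by positivity
      nlinarith [(hs i).2]
    have hkp : ∀ n, par (k (n + 1)) = k n := by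
      intro n
      funext i
      simp only [par, k]
      rw [← Nat.floor_div_natCast]
      congr 1
      push_cast
      rw [pow_succ]
      ring
    have hk0 : g 0 (k 0) = 0 := by
      funext i
      have : k 0 i = 0 := by
        have := Fintype.mem_piFinset.1 (hk 0) i
        simpa using this
      simp [g, this]
    have hbound : ∀ n : ℕ, |Y (g n (k n)) ω| ≤ u * B * (5 - (n + 2) * 2 / 2 ^ n) := by
      intro n
      induction n with
      | zero =>
        rw [hk0]
        have : |Y 0 ω| ≤ u * B := not_lt.1 hc0
        norm_num
        linarith
      | succ n ih =>
        have h1 := hc1 n (k (n + 1)) (hk (n + 1))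
        have h2 : |Y (g (n + 1) (k (n + 1))) ω - Y (g n (par (k (n + 1)))) ω| ≤
          u * B * (n + 1) / 2 ^ n := not_lt.1 h1
        rw [hkp] at h2
        have h3 := abs_sub_abs_le_abs_sub (Y (g (n + 1) (k (n + 1))) ω) (Y (g n (k n)) ω)
        have e : u * B * (5 - (((n + 1 : ℕ) : ℝ) + 2) * 2 / 2 ^ (n + 1)) =
          u * B * (5 - (n + 2) * 2 / 2 ^ n) + u * B * (n + 1) / 2 ^ n := by
          push_cast
          rw [pow_succ]
          field_simp
          ring
        rw [e]
        linarith
    have htend : Filter.Tendsto (fun n => g n (k n)) Filter.atTop (nhds s) := by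
      rw [tendsto_pi_nhds]
      intro i
      have hz : Filter.Tendsto (fun n : ℕ => ((4 : ℝ)⁻¹) ^ n) Filter.atTop (nhds 0) :=
        tendsto_pow_atTop_nhds_zero_of_lt_one (by norm_num) (by norm_num)
      rw [tendsto_iff_norm_sub_tendsto_zero]
      refine squeeze_zero (fun _ => norm_nonneg _) (fun n => ?_) hz
      have hp : (0 : ℝ) < 4 ^ n := by positivity
      have f1 := Nat.floor_le (mul_nonneg hp.le (hs i).1)
      have f2 := Nat.lt_floor_add_one (4 ^ n * s i)
      simp only [g, k]
      rw [Real.norm_eq_abs, abs_le, inv_pow]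
      have e : (⌊4 ^ n * s i⌋₊ : ℝ) / 4 ^ n - s i = (⌊4 ^ n * s i⌋₊ - 4 ^ n * s i) * (4 ^ n)⁻¹ := by
        field_simp
      have hp' : (0 : ℝ) < (4 ^ n)⁻¹ := by positivity
      rw [e]
      constructor <;> nlinarith
    have hlim := ((hcont ω s hs).tendsto.comp htend).abs
    have : |Y s ω| ≤ 5 * B * u := by
      refine le_of_tendsto hlim (Filter.Eventually.of_forall fun n => ?_)
      refine (hbound n).trans ?_
      have : (0 : ℝ) ≤ (n + 2) * 2 / 2 ^ n := by positivity
      have : 0 < u * B := by positivity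
      nlinarith
    linarith
  calc _ ≤ P bad0 + ∑' n, P (⋃ k ∈ lev (n + 1), bad n k) :=
        (measure_mono hsub).trans ((measure_union_le _ _).trans (by gcongr; exact measure_iUnion_le _))
    _ ≤ ENNReal.ofReal (2 * Real.exp (-u ^ 2)) +
        ∑' n : ℕ, ENNReal.ofReal (2 * Real.exp (-u ^ 2)) * (2⁻¹) ^ (n + 1) := by
        gcongr with n
        exact hsum n
    _ = ENNReal.ofReal (2 * Real.exp (-u ^ 2)) + ENNReal.ofReal (2 * Real.exp (-u ^ 2)) := by
        rw [ENNReal.tsum_mul_left, ENNReal.tsum_geometric_add_one]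
        congr 1
        rw [ENNReal.one_sub_inv_two, inv_inv, ENNReal.inv_mul_cancel (by norm_num) (by norm_num),
          mul_one]
    _ = _ := by
        rw [← ENNReal.ofReal_add (by positivity) (by positivity)]
        congr 1
        ring

lemma aux_prod_s14 {m : ℕ} (x y : Fin m → ℝ) (M δ : ℝ) (hM : 1 ≤ M) (hδ : 0 ≤ δ)
    (hx : ∀ k, 0 ≤ x k ∧ x k ≤ M) (hy : ∀ k, 0 ≤ y k ∧ y k ≤ M) (hxy : ∀ k, |x k - y k| ≤ δ) :
    |∏ k, x k - ∏ k, y k| ≤ m * M ^ m * δ := by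
  have key : ∀ s : Finset (Fin m), |∏ k ∈ s, x k - ∏ k ∈ s, y k| ≤ s.card * M ^ s.card * δ := by
    intro s
    induction s using Finset.induction_on with
    | empty => simp
    | insert i s hi ih =>
      rw [Finset.prod_insert hi, Finset.prod_insert hi, Finset.card_insert_of_notMem hi]
      have e : x i * ∏ k ∈ s, x k - y i * ∏ k ∈ s, y k =
        x i * (∏ k ∈ s, x k - ∏ k ∈ s, y k) + (x i - y i) * ∏ k ∈ s, y k := by ring
      have hy' : ∏ k ∈ s, y k ≤ M ^ s.card := by
        rw [← Finset.prod_const]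
        exact Finset.prod_le_prod (fun k _ => (hy k).1) (fun k _ => (hy k).2)
      have hy0 : 0 ≤ ∏ k ∈ s, y k := Finset.prod_nonneg fun k _ => (hy k).1
      have hMp : 1 ≤ M ^ s.card := one_le_pow₀ hM
      rw [e]
      calc _ ≤ |x i| * |∏ k ∈ s, x k - ∏ k ∈ s, y k| + |x i - y i| * |∏ k ∈ s, y k| := by
            rw [← abs_mul, ← abs_mul]; exact abs_add_le _ _
        _ ≤ M * (s.card * M ^ s.card * δ) + δ * M ^ s.card := by
            rw [abs_of_nonneg (hx i).1, abs_of_nonneg hy0]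
            have h1 := (hx i).2
            have h2 := hxy i
            gcongr
        _ ≤ _ := by
            push_cast
            rw [pow_succ]
            have : δ * M ^ s.card ≤ δ * M ^ s.card * M := le_mul_of_one_le_right (by positivity) hM
            nlinarith
  simpa using key Finset.univ

lemma aux_diff (x y e δ : ℝ) (hx : 0 ≤ x ∧ x < 1) (hy : 0 ≤ y ∧ y < 1) (he : 0 ≤ e)
    (h : |x - y| ≤ δ) :
    |(e + x / (1 - x)) - (e + y / (1 - y))| ≤ δ * ((1 + (e + x / (1 - x))) * (1 + (e + y / (1 - y)))) := by
  have h1 : 0 < 1 - x := by linarith [hx.2]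
  have h2 : 0 < 1 - y := by linarith [hy.2]
  have e1 : (e + x / (1 - x)) - (e + y / (1 - y)) = (x - y) * ((1 + x / (1 - x)) * (1 + y / (1 - y))) := by
    field_simp
    ring
  have hx0 := hx.1
  have hy0 := hy.1
  have a1 : 0 ≤ x / (1 - x) := by positivity
  have a2 : 0 ≤ y / (1 - y) := by positivity
  have hδ : 0 ≤ δ := (abs_nonneg _).trans h
  rw [e1, abs_mul, abs_of_nonneg (a := (1 + x / (1 - x)) * (1 + y / (1 - y))) (by positivity)]
  gcongr <;> linarith

lemma aux_rho (p1 p2 q1 q2 ε δ : ℝ) (hε : 0 < ε) (hδ : 0 ≤ δ)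
    (hp1 : 0 ≤ p1) (hp2 : 0 ≤ p2) (hq1 : 0 ≤ q1) (hq2 : 0 ≤ q2)
    (hp : ε ≤ p1 + p2) (hq : ε ≤ q1 + q2)
    (h1 : |p1 - q1| ≤ δ * ((1 + p1) * (1 + q1))) (h2 : |p2 - q2| ≤ δ * ((1 + p2) * (1 + q2))) :
    |1 / (p1 + p2) - (min p1 q1 + min p2 q2) / ((p1 + p2) * (q1 + q2))| ≤
      2 * (1 + 1 / ε) ^ 2 * δ ∧
    |1 / (q1 + q2) - (min p1 q1 + min p2 q2) / ((p1 + p2) * (q1 + q2))| ≤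
      2 * (1 + 1 / ε) ^ 2 * δ ∧
    (0 ≤ 1 / (p1 + p2) ∧ 1 / (p1 + p2) ≤ 1 + 1 / ε) ∧
    (0 ≤ 1 / (q1 + q2) ∧ 1 / (q1 + q2) ≤ 1 + 1 / ε) ∧
    (0 ≤ (min p1 q1 + min p2 q2) / ((p1 + p2) * (q1 + q2)) ∧
      (min p1 q1 + min p2 q2) / ((p1 + p2) * (q1 + q2)) ≤ 1 + 1 / ε) := by
  have hl : 0 < p1 + p2 := by linarith
  have hl' : 0 < q1 + q2 := by linarith
  set M := 1 + 1 / ε with hM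
  have hM0 : 0 < M := by positivity
  have hMb : ∀ a b : ℝ, 0 ≤ a → 0 ≤ b → ε ≤ a + b → 1 + a ≤ M * (a + b) := by
    intro a b ha hb hab
    have : 1 ≤ 1 / ε * (a + b) := by
      rw [one_div, ← div_eq_inv_mul, le_div_iff₀ hε]; linarith
    rw [hM]; nlinarith
  have i1 : ∀ a b : ℝ, 0 ≤ a → a ≤ M * (p1 + p2) → 0 ≤ b → b ≤ M * (q1 + q2) →
      δ * (a * b) ≤ δ * M ^ 2 * ((p1 + p2) * (q1 + q2)) := by
    intro a b ha ha' hb hb'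
    calc δ * (a * b) ≤ δ * ((M * (p1 + p2)) * (M * (q1 + q2))) := by gcongr
      _ = _ := by ring
  have j1 := h1.trans (i1 _ _ (by linarith) (hMb p1 p2 hp1 hp2 hp) (by linarith) (hMb q1 q2 hq1 hq2 hq))
  have j2 := h2.trans (i1 _ _ (by linarith) (by rw [add_comm p1 p2]; exact hMb p2 p1 hp2 hp1 (by linarith))
    (by linarith) (by rw [add_comm q1 q2]; exact hMb q2 q1 hq2 hq1 (by linarith)))
  have m1 : min p1 q1 ≤ p1 := min_le_left _ _
  have m2 : min p1 q1 ≤ q1 := min_le_right _ _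
  have m3 : min p2 q2 ≤ p2 := min_le_left _ _
  have m4 : min p2 q2 ≤ q2 := min_le_right _ _
  have n1 : p1 - |p1 - q1| ≤ min p1 q1 := by
    rw [le_min_iff]; constructor <;> linarith [abs_nonneg (p1 - q1), le_abs_self (p1 - q1)]
  have n2 : q1 - |p1 - q1| ≤ min p1 q1 := by
    rw [le_min_iff]; constructor <;> linarith [abs_nonneg (p1 - q1), neg_abs_le (p1 - q1)]
  have n3 : p2 - |p2 - q2| ≤ min p2 q2 := by
    rw [le_min_iff]; constructor <;> linarith [abs_nonneg (p2 - q2), le_abs_self (p2 - q2)]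
  have n4 : q2 - |p2 - q2| ≤ min p2 q2 := by
    rw [le_min_iff]; constructor <;> linarith [abs_nonneg (p2 - q2), neg_abs_le (p2 - q2)]
  have z1 : 0 ≤ min p1 q1 := le_min hp1 hq1
  have z2 : 0 ≤ min p2 q2 := le_min hp2 hq2
  generalize min p1 q1 = I1 at *
  generalize min p2 q2 = I2 at *
  have hinv : ∀ l : ℝ, ε ≤ l → 1 / l ≤ M := by
    intro l hl
    have : 1 / l ≤ 1 / ε := one_div_le_one_div_of_le hε hl
    linarith
  have hll : 0 < (p1 + p2) * (q1 + q2) := by positivity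
  refine ⟨?_, ?_, ⟨by positivity, hinv _ hp⟩, ⟨by positivity, hinv _ hq⟩, by positivity, ?_⟩
  · have e : 1 / (p1 + p2) - (I1 + I2) / ((p1 + p2) * (q1 + q2)) =
      (q1 + q2 - (I1 + I2)) / ((p1 + p2) * (q1 + q2)) := by field_simp
    rw [e, abs_of_nonneg (div_nonneg (by linarith) hll.le), div_le_iff₀ hll]
    linarith
  · have e : 1 / (q1 + q2) - (I1 + I2) / ((p1 + p2) * (q1 + q2)) =
      (p1 + p2 - (I1 + I2)) / ((p1 + p2) * (q1 + q2)) := by field_simp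
    rw [e, abs_of_nonneg (div_nonneg (by linarith) hll.le), div_le_iff₀ hll]
    linarith
  · refine le_trans ?_ (hinv _ hp)
    rw [div_le_div_iff₀ hll hl]
    nlinarith

lemma aux_var {Ω T : Type*} [MeasurableSpace Ω] (P : Measure Ω) [IsProbabilityMeasure P]
    (G : T → Ω → ℝ) (hG : IsCenteredGaussianProcess P G) (p q : T) (c d : ℝ) :
    ∃ v : NNReal, P.map (fun ω => c * G p ω - d * G q ω) = gaussianReal 0 v ∧
      (v : ℝ) = c ^ 2 * (∫ ω, G p ω * G p ω ∂P) - 2 * (c * d) * (∫ ω, G p ω * G q ω ∂P)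
        + d ^ 2 * ∫ ω, G q ω * G q ω ∂P := by
  obtain ⟨hm, hl⟩ := hG
  obtain ⟨v, hv⟩ := hl 2 ![p, q] ![c, -d]
  have e : (fun ω => ∑ i : Fin 2, (![c, -d] : Fin 2 → ℝ) i * G ((![p, q] : Fin 2 → T) i) ω) =
      fun ω => c * G p ω - d * G q ω := by
    funext ω
    simp [Fin.sum_univ_two, sub_eq_add_neg]
  rw [e] at hv
  refine ⟨v, hv, ?_⟩
  have hL : ∀ t, MemLp (G t) 2 P := by
    intro t
    obtain ⟨w, hw⟩ := hl 1 (fun _ => t) (fun _ => 1)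
    simp only [Finset.univ_unique, Fin.default_eq_zero, one_mul, Finset.sum_const,
      Finset.card_singleton, one_smul] at hw
    have h2 : MemLp id 2 (P.map (G t)) := by
      have : P.map (G t) = gaussianReal 0 w := hw
      rw [this]; exact memLp_id_gaussianReal 2
    exact (memLp_map_measure_iff (by fun_prop) (hm t).aemeasurable).1 h2
  have hint : ∀ s t, Integrable (fun ω => G s ω * G t ω) P := fun s t => (hL s).integrable_mul (hL t)
  have hZm : Measurable (fun ω => c * G p ω - d * G q ω) :=
    ((hm p).const_mul c).sub ((hm q).const_mul d)
  have hvar : (v : ℝ) = ∫ x, x ^ 2 ∂(gaussianReal 0 v) := by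
    rw [← variance_fun_id_gaussianReal (μ := 0) (v := v),
      variance_of_integral_eq_zero (by fun_prop) integral_id_gaussianReal]
  rw [hvar, ← hv, integral_map hZm.aemeasurable (by fun_prop)]
  have e2 : (fun ω => (c * G p ω - d * G q ω) ^ 2) = fun ω =>
      c ^ 2 * (G p ω * G p ω) - 2 * (c * d) * (G p ω * G q ω) + d ^ 2 * (G q ω * G q ω) := by
    funext ω; ring
  rw [e2, integral_add, integral_sub, integral_const_mul, integral_const_mul, integral_const_mul]
  · exact (hint _ _).const_mul _
  · exact (hint _ _).const_mul _
  · exact ((hint _ _).const_mul _).sub ((hint _ _).const_mul _)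
  · exact (hint _ _).const_mul _

lemma aux_sup (m : ℕ) {Ω : Type*} [MeasurableSpace Ω] (P : Measure Ω) [IsProbabilityMeasure P]
    (𝔾 : (Fin m → NNReal) × (Fin m → NNReal) → Ω → ℝ)
    (hGauss : IsCenteredGaussianProcess P 𝔾)
    (hcov : ∀ p q : (Fin m → NNReal) × (Fin m → NNReal),
      ∫ ω, 𝔾 p ω * 𝔾 q ω ∂P =
        ∏ k : Fin m, (((min (p.1 k) (q.1 k) : NNReal) : ℝ) +
          ((min (p.2 k) (q.2 k) : NNReal) : ℝ)))
    (hcont : ∀ ω : Ω, Continuous (fun p : (Fin m → NNReal) × (Fin m → NNReal) => 𝔾 p ω))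
    (e1 e2 : NNReal) (he : 0 < e1 + e2) :
    ∃ K : ℝ, 0 < K ∧ ∀ u : ℝ, 1 ≤ u →
      P {ω | ∃ h₁ h₂ : Fin m → NNReal, (∀ k, e1 ≤ h₁ k) ∧ (∀ k, e2 ≤ h₂ k) ∧
        K * u < |𝔾 (h₁, h₂) ω / ∏ k : Fin m, ((h₁ k : ℝ) + (h₂ k : ℝ))|} ≤
        ENNReal.ofReal (4 * Real.exp (-u ^ 2)) := by
  let φ : ℝ → NNReal := fun x => Real.toNNReal (x / (1 - x))
  have hφ : ∀ x : ℝ, 0 ≤ x → x < 1 → ((φ x : NNReal) : ℝ) = x / (1 - x) := fun x h0 h1 =>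
    Real.coe_toNNReal _ (div_nonneg h0 (by linarith))
  let H : (Fin m ⊕ Fin m → ℝ) → (Fin m → NNReal) × (Fin m → NNReal) := fun s =>
    (fun k => e1 + φ (s (Sum.inl k)), fun k => e2 + φ (s (Sum.inr k)))
  let c : (Fin m ⊕ Fin m → ℝ) → ℝ := fun s => (∏ k : Fin m, (((H s).1 k : ℝ) + ((H s).2 k : ℝ)))⁻¹
  let Y : (Fin m ⊕ Fin m → ℝ) → Ω → ℝ := fun s ω => c s * 𝔾 (H s) ω
  set ε : ℝ := ((e1 + e2 : NNReal) : ℝ) with hεd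
  have hε : 0 < ε := by exact_mod_cast he
  have hεs : ∀ s k, ε ≤ ((H s).1 k : ℝ) + ((H s).2 k : ℝ) := by
    intro s k
    simp only [H, hεd]
    push_cast
    have := (φ (s (Sum.inl k))).2
    have := (φ (s (Sum.inr k))).2
    linarith [NNReal.coe_nonneg (φ (s (Sum.inl k))), NNReal.coe_nonneg (φ (s (Sum.inr k)))]
  set M : ℝ := 1 + 1 / ε with hM
  have hM1 : 1 ≤ M := by have : 0 < 1 / ε := by positivity
                         linarith
  have hMm : 1 ≤ M ^ m := one_le_pow₀ hM1
  let L : ℝ := 4 * m * M ^ m * M ^ 2 + M ^ m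
  have hL : 0 < L := by positivity
  have hmeas : ∀ s, Measurable (Y s) := fun s => (hGauss.1 (H s)).const_mul _
  refine Exists.imp ?_ (aux_chain P Y hmeas L hL ?_ ?_ ?_)
  · rintro K ⟨hK, hKu⟩
    refine ⟨hK, fun u hu => le_trans (measure_mono ?_) (hKu u hu)⟩
    rintro ω ⟨h₁, h₂, hh1, hh2, hlt⟩
    let ψ : ℝ → ℝ := fun t => t / (1 + t)
    have hψ : ∀ t : ℝ, 0 ≤ t → 0 ≤ ψ t ∧ ψ t < 1 := by
      intro t ht
      refine ⟨by positivity, ?_⟩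
      simp only [ψ]
      rw [div_lt_one (by linarith)]
      linarith
    have hφψ : ∀ t : NNReal, φ (ψ t) = t := by
      intro t
      have ht : (0 : ℝ) ≤ t := t.2
      have : ψ t / (1 - ψ t) = t := by
        simp only [ψ]
        have : (1 : ℝ) + t ≠ 0 := by positivity
        field_simp
        ring
      simp only [φ, this, Real.toNNReal_coe]
    let s : Fin m ⊕ Fin m → ℝ :=
      Sum.elim (fun k => ψ ((h₁ k - e1 : NNReal) : ℝ)) (fun k => ψ ((h₂ k - e2 : NNReal) : ℝ))
    have hHs : H s = (h₁, h₂) := by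
      simp only [H, s, Sum.elim_inl, Sum.elim_inr, hφψ]
      refine Prod.ext ?_ ?_
      · funext k; exact add_tsub_cancel_of_le (hh1 k)
      · funext k; exact add_tsub_cancel_of_le (hh2 k)
    refine ⟨s, ?_, ?_⟩
    · rintro (k | k)
      · exact hψ _ (NNReal.coe_nonneg _)
      · exact hψ _ (NNReal.coe_nonneg _)
    · simp only [Y, c, hHs]
      rw [div_eq_inv_mul] at hlt
      exact hlt
  · obtain ⟨v, hv, hve⟩ := aux_var P 𝔾 hGauss (H 0) (H 0) (c 0) 0
    refine ⟨v, ?_, ?_⟩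
    · rw [← hv]
      simp [Y]
    · rw [hve, hcov]
      simp only [min_self]
      have hpos : 0 < ∏ k : Fin m, (((H 0).1 k : ℝ) + ((H 0).2 k : ℝ)) :=
        Finset.prod_pos fun k _ => lt_of_lt_of_le hε (hεs 0 k)
      have : c 0 ^ 2 * (∏ k : Fin m, (((H 0).1 k : ℝ) + ((H 0).2 k : ℝ))) =
          ∏ k : Fin m, (((H 0).1 k : ℝ) + ((H 0).2 k : ℝ))⁻¹ := by
        rw [Finset.prod_inv_distrib]
        simp only [c]
        field_simp
      rw [this]
      have h3 : ∏ k : Fin m, (((H 0).1 k : ℝ) + ((H 0).2 k : ℝ))⁻¹ ≤ M ^ m := by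
        calc _ ≤ ∏ k : Fin m, M := by
              refine Finset.prod_le_prod (fun k _ => by positivity) fun k _ => ?_
              have := one_div_le_one_div_of_le hε (hεs 0 k)
              rw [one_div] at this
              linarith
          _ = M ^ m := by simp
      have : 0 ≤ 4 * m * M ^ m * M ^ 2 := by positivity
      simp only [L]
      linarith
  · intro s s' hs hs' δ hδ hd
    obtain ⟨v, hv, hve⟩ := aux_var P 𝔾 hGauss (H s) (H s') (c s) (c s')
    refine ⟨v, hv, ?_⟩
    rw [hve, hcov, hcov, hcov]
    simp only [min_self]
    have hp : ∀ s, 0 < ∏ k : Fin m, (((H s).1 k : ℝ) + ((H s).2 k : ℝ)) := fun s =>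
      Finset.prod_pos fun k _ => lt_of_lt_of_le hε (hεs s k)
    have hc1 : ∀ s, c s ^ 2 * (∏ k : Fin m, (((H s).1 k : ℝ) + ((H s).2 k : ℝ))) =
        ∏ k : Fin m, 1 / (((H s).1 k : ℝ) + ((H s).2 k : ℝ)) := by
      intro s
      have := hp s
      rw [Finset.prod_div_distrib, Finset.prod_const_one]
      simp only [c]
      field_simp
    have hc2 : c s * c s' * (∏ k : Fin m, (((min ((H s).1 k) ((H s').1 k) : NNReal) : ℝ) +
          ((min ((H s).2 k) ((H s').2 k) : NNReal) : ℝ))) =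
        ∏ k : Fin m, (min ((H s).1 k : ℝ) ((H s').1 k) + min ((H s).2 k : ℝ) ((H s').2 k)) /
          ((((H s).1 k : ℝ) + ((H s).2 k : ℝ)) * (((H s').1 k : ℝ) + ((H s').2 k : ℝ))) := by
      rw [Finset.prod_div_distrib, Finset.prod_mul_distrib]
      simp only [c, NNReal.coe_min]
      have := hp s
      have := hp s'
      field_simp
    rw [mul_assoc 2, hc1, hc1, hc2]
    have hr := fun k => aux_rho ((H s).1 k) ((H s).2 k) ((H s').1 k) ((H s').2 k) ε δ hε hδ.le
      (NNReal.coe_nonneg _) (NNReal.coe_nonneg _) (NNReal.coe_nonneg _) (NNReal.coe_nonneg _)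
      (hεs s k) (hεs s' k)
      (by
        simp only [H]; push_cast
        rw [hφ _ (hs _).1 (hs _).2, hφ _ (hs' _).1 (hs' _).2]
        exact aux_diff _ _ _ _ (hs _) (hs' _) (NNReal.coe_nonneg _) (hd _))
      (by
        simp only [H]; push_cast
        rw [hφ _ (hs _).1 (hs _).2, hφ _ (hs' _).1 (hs' _).2]
        exact aux_diff _ _ _ _ (hs _) (hs' _) (NNReal.coe_nonneg _) (hd _))
    have b1 := le_of_abs_le (aux_prod_s14 _ _ M (2 * M ^ 2 * δ) hM1 (by positivity)
      (fun k => (hr k).2.2.1) (fun k => (hr k).2.2.2.2) (fun k => (hr k).1))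
    have b2 := le_of_abs_le (aux_prod_s14 _ _ M (2 * M ^ 2 * δ) hM1 (by positivity)
      (fun k => (hr k).2.2.2.1) (fun k => (hr k).2.2.2.2) (fun k => (hr k).2.1))
    have : 0 ≤ M ^ m * δ := by positivity
    simp only [L]
    linarith
  · intro ω s hs
    have hφc : ∀ i, ContinuousAt (fun s : Fin m ⊕ Fin m → ℝ => φ (s i)) s := by
      intro i
      have h1 : ContinuousAt (fun s : Fin m ⊕ Fin m → ℝ => s i / (1 - s i)) s := by
        refine ContinuousAt.div (continuous_apply i).continuousAt
          (continuous_const.sub (continuous_apply i)).continuousAt ?_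
        linarith [(hs i).2]
      exact continuous_real_toNNReal.continuousAt.comp h1
    have hH : ContinuousAt H s := by
      refine ContinuousAt.prodMk ?_ ?_
      · exact continuousAt_pi.2 fun k => continuousAt_const.add (hφc _)
      · exact continuousAt_pi.2 fun k => continuousAt_const.add (hφc _)
    have hc : ContinuousAt c s := by
      refine ContinuousAt.inv₀ ?_ (Finset.prod_pos fun k _ => lt_of_lt_of_le hε (hεs s k)).ne'
      have : Continuous (fun p : (Fin m → NNReal) × (Fin m → NNReal) =>
        ∏ k : Fin m, ((p.1 k : ℝ) + (p.2 k : ℝ))) := by fun_prop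
      exact this.continuousAt.comp hH
    exact hc.mul ((hcont ω).continuousAt.comp hH)

lemma aux_drift (x y : ℝ) (n : ℕ) (hx : 0 < x) (hy : 0 ≤ y) :
    -x ^ n ≤ (y ^ (n + 1) - x ^ (n + 1)) / (y + x) := by
  rw [le_div_iff₀ (by linarith), pow_succ x]
  have : 0 ≤ y ^ (n + 1) := by positivity
  have : 0 ≤ x ^ n * y := by positivity
  nlinarith

lemma aux_drift' (x y : ℝ) (n : ℕ) (hx : 0 ≤ x) (hy : 0 < y) :
    (y ^ (n + 1) - x ^ (n + 1)) / (y + x) ≤ y ^ n := by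
  rw [div_le_iff₀ (by linarith), pow_succ y]
  have : 0 ≤ x ^ (n + 1) := by positivity
  have : 0 ≤ y ^ n * x := by positivity
  nlinarith

lemma aux_W {T : Type*} (p : T → Prop) (F : T → T → ℝ) (c : ℝ) (hc : 0 ≤ c) (e : T) (he : p e)
    (h1 : ∀ x, p x → F x e ≤ c) (h2 : ∀ y, p y → -c ≤ F e y) :
    BddAbove {w : ℝ | ∃ x, p x ∧ w = sInf {z : ℝ | ∃ y, p y ∧ z = F x y}} ∧
    |sSup {w : ℝ | ∃ x, p x ∧ w = sInf {z : ℝ | ∃ y, p y ∧ z = F x y}}| ≤ c := by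
  have hub : ∀ w ∈ {w : ℝ | ∃ x, p x ∧ w = sInf {z : ℝ | ∃ y, p y ∧ z = F x y}}, w ≤ c := by
    rintro w ⟨x, hx, rfl⟩
    by_cases hb : BddBelow {z : ℝ | ∃ y, p y ∧ z = F x y}
    · exact (csInf_le hb ⟨e, he, rfl⟩).trans (h1 x hx)
    · rw [Real.sInf_of_not_bddBelow hb]; exact hc
  have hbd : BddAbove {w : ℝ | ∃ x, p x ∧ w = sInf {z : ℝ | ∃ y, p y ∧ z = F x y}} := ⟨c, hub⟩
  refine ⟨hbd, abs_le.2 ⟨?_, csSup_le ⟨_, e, he, rfl⟩ hub⟩⟩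
  refine le_trans ?_ (le_csSup hbd ⟨e, he, rfl⟩)
  refine le_csInf ⟨_, e, he, rfl⟩ ?_
  rintro z ⟨y, hy, rfl⟩
  exact h2 y hy

lemma aux_ae {Ω : Type*} [MeasurableSpace Ω] (P : Measure Ω) (Q : ℝ → Ω → Prop)
    (h : ∀ u : ℝ, 1 ≤ u → P {ω | Q u ω} ≤ ENNReal.ofReal (4 * Real.exp (-u ^ 2))) :
    ∀ᵐ ω ∂P, ∃ u : ℝ, 1 ≤ u ∧ ¬ Q u ω := by
  rw [ae_iff]
  have ht : Filter.Tendsto (fun u : ℝ => ENNReal.ofReal (4 * Real.exp (-u ^ 2))) Filter.atTop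
      (nhds 0) := by
    rw [← ENNReal.ofReal_zero]
    refine ENNReal.tendsto_ofReal ?_
    rw [← mul_zero (4 : ℝ)]
    refine Filter.Tendsto.const_mul _ ?_
    exact Real.tendsto_exp_neg_atTop_nhds_zero.comp (Filter.tendsto_pow_atTop (by norm_num))
  refine le_antisymm (ge_of_tendsto ht ?_) (zero_le)
  filter_upwards [Filter.eventually_ge_atTop 1] with u hu
  refine (measure_mono ?_).trans (h u hu)
  intro ω hω
  by_contra hc
  exact hω ⟨u, hu, hc⟩

/-- Lemma 4 of the paper: the sup–inf random variable
`W = sup_{h₁>0} inf_{h₂>0} [σ·𝔾(h₁,h₂)/∏_k((h₁)_k+(h₂)_k) +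
Σ_k a_k((h₂)_k^{α_k+1}−(h₁)_k^{α_k+1})/((h₂)_k+(h₁)_k)]`
is almost surely finite and has a sub-Gaussian tail. -/
theorem stmt14 (m : ℕ) (hm : 1 ≤ m) (σ : ℝ) (hσ : 0 < σ)
    (α : Fin m → ℕ) (hαodd : ∀ k, Odd (α k))
    (a : Fin m → ℝ) (ha : ∀ k, 0 < a k)
    {Ω : Type*} [MeasurableSpace Ω] (P : Measure Ω) [IsProbabilityMeasure P]
    (𝔾 : (Fin m → NNReal) × (Fin m → NNReal) → Ω → ℝ)
    (hGauss : IsCenteredGaussianProcess P 𝔾)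
    (hcov : ∀ p q : (Fin m → NNReal) × (Fin m → NNReal),
      ∫ ω, 𝔾 p ω * 𝔾 q ω ∂P =
        ∏ k : Fin m, (((min (p.1 k) (q.1 k) : NNReal) : ℝ) +
          ((min (p.2 k) (q.2 k) : NNReal) : ℝ)))
    (hcont : ∀ ω : Ω, Continuous (fun p : (Fin m → NNReal) × (Fin m → NNReal) => 𝔾 p ω)) :
    (∀ᵐ ω ∂P,
      BddAbove {y : ℝ | ∃ h₁ : Fin m → NNReal, (∀ k, 0 < h₁ k) ∧
        y = sInf {z : ℝ | ∃ h₂ : Fin m → NNReal, (∀ k, 0 < h₂ k) ∧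
          z = σ * 𝔾 (h₁, h₂) ω / ∏ k : Fin m, ((h₁ k : ℝ) + (h₂ k : ℝ)) +
            ∑ k : Fin m, a k * ((h₂ k : ℝ) ^ (α k + 1) - (h₁ k : ℝ) ^ (α k + 1)) /
              ((h₂ k : ℝ) + (h₁ k : ℝ))}} ∧
      ∀ h₁ : Fin m → NNReal, (∀ k, 0 < h₁ k) →
        BddBelow {z : ℝ | ∃ h₂ : Fin m → NNReal, (∀ k, 0 < h₂ k) ∧
          z = σ * 𝔾 (h₁, h₂) ω / ∏ k : Fin m, ((h₁ k : ℝ) + (h₂ k : ℝ)) +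
            ∑ k : Fin m, a k * ((h₂ k : ℝ) ^ (α k + 1) - (h₁ k : ℝ) ^ (α k + 1)) /
              ((h₂ k : ℝ) + (h₁ k : ℝ))}) ∧
    ∃ C : ℝ, 0 < C ∧ ∀ u : ℝ, 0 < u →
      P {ω : Ω |
        u < |sSup {y : ℝ | ∃ h₁ : Fin m → NNReal, (∀ k, 0 < h₁ k) ∧
          y = sInf {z : ℝ | ∃ h₂ : Fin m → NNReal, (∀ k, 0 < h₂ k) ∧
            z = σ * 𝔾 (h₁, h₂) ω / ∏ k : Fin m, ((h₁ k : ℝ) + (h₂ k : ℝ)) +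
              ∑ k : Fin m, a k * ((h₂ k : ℝ) ^ (α k + 1) - (h₁ k : ℝ) ^ (α k + 1)) /
                ((h₂ k : ℝ) + (h₁ k : ℝ))}}|} ≤
        ENNReal.ofReal (2 * Real.exp (-u ^ 2 / C)) := by
  obtain ⟨K1, hK1, hT1⟩ := aux_sup m P 𝔾 hGauss hcov hcont 1 0 (by norm_num)
  obtain ⟨K2, hK2, hT2⟩ := aux_sup m P 𝔾 hGauss hcov hcont 0 1 (by norm_num)
  set A : ℝ := ∑ k, a k with hA
  have hA0 : 0 ≤ A := Finset.sum_nonneg fun k _ => (ha k).le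
  set B : ℝ := A + σ * (K1 + K2) with hB
  have hB0 : 0 < B := by positivity
  let F : Ω → (Fin m → NNReal) → (Fin m → NNReal) → ℝ := fun ω h₁ h₂ =>
    σ * 𝔾 (h₁, h₂) ω / ∏ k : Fin m, ((h₁ k : ℝ) + (h₂ k : ℝ)) +
      ∑ k : Fin m, a k * ((h₂ k : ℝ) ^ (α k + 1) - (h₁ k : ℝ) ^ (α k + 1)) /
        ((h₂ k : ℝ) + (h₁ k : ℝ))
  let Q1 : ℝ → Ω → Prop := fun u ω => ∃ h₁ h₂ : Fin m → NNReal, (∀ k, 1 ≤ h₁ k) ∧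
    (∀ k, 0 ≤ h₂ k) ∧ K1 * u < |𝔾 (h₁, h₂) ω / ∏ k : Fin m, ((h₁ k : ℝ) + (h₂ k : ℝ))|
  let Q2 : ℝ → Ω → Prop := fun u ω => ∃ h₁ h₂ : Fin m → NNReal, (∀ k, 0 ≤ h₁ k) ∧
    (∀ k, 1 ≤ h₂ k) ∧ K2 * u < |𝔾 (h₁, h₂) ω / ∏ k : Fin m, ((h₁ k : ℝ) + (h₂ k : ℝ))|
  have hlow : ∀ ω (h₁ h₂ : Fin m → NNReal) (c : ℝ), (∀ k, 0 < h₁ k) →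
      |𝔾 (h₁, h₂) ω / ∏ k : Fin m, ((h₁ k : ℝ) + (h₂ k : ℝ))| ≤ c →
      -(σ * c + ∑ k, a k * (h₁ k : ℝ) ^ α k) ≤ F ω h₁ h₂ := by
    intro ω h₁ h₂ c hp hc
    have d : -∑ k, a k * (h₁ k : ℝ) ^ α k ≤
        ∑ k : Fin m, a k * ((h₂ k : ℝ) ^ (α k + 1) - (h₁ k : ℝ) ^ (α k + 1)) /
        ((h₂ k : ℝ) + (h₁ k : ℝ)) := by
      rw [← Finset.sum_neg_distrib]
      refine Finset.sum_le_sum fun k _ => ?_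
      rw [mul_div_assoc, ← mul_neg]
      exact mul_le_mul_of_nonneg_left
        (aux_drift _ _ _ (by exact_mod_cast hp k) (NNReal.coe_nonneg _)) (ha k).le
    have g := mul_le_mul_of_nonneg_left (abs_le.1 hc).1 hσ.le
    simp only [F]
    rw [mul_div_assoc]
    linarith
  have hup : ∀ ω (h₁ h₂ : Fin m → NNReal) (c : ℝ), (∀ k, 0 < h₂ k) →
      |𝔾 (h₁, h₂) ω / ∏ k : Fin m, ((h₁ k : ℝ) + (h₂ k : ℝ))| ≤ c →
      F ω h₁ h₂ ≤ σ * c + ∑ k, a k * (h₂ k : ℝ) ^ α k := by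
    intro ω h₁ h₂ c hp hc
    have d : ∑ k : Fin m, a k * ((h₂ k : ℝ) ^ (α k + 1) - (h₁ k : ℝ) ^ (α k + 1)) /
        ((h₂ k : ℝ) + (h₁ k : ℝ)) ≤ ∑ k, a k * (h₂ k : ℝ) ^ α k := by
      refine Finset.sum_le_sum fun k _ => ?_
      rw [mul_div_assoc]
      exact mul_le_mul_of_nonneg_left
        (aux_drift' _ _ _ (NNReal.coe_nonneg _) (by exact_mod_cast hp k)) (ha k).le
    have g := mul_le_mul_of_nonneg_left (abs_le.1 hc).2 hσ.le
    simp only [F]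
    rw [mul_div_assoc]
    linarith
  have hdet : ∀ ω u, 1 ≤ u → ¬ Q1 u ω → ¬ Q2 u ω → 
      BddAbove {y : ℝ | ∃ h₁ : Fin m → NNReal, (∀ k, 0 < h₁ k) ∧
        y = sInf {z : ℝ | ∃ h₂ : Fin m → NNReal, (∀ k, 0 < h₂ k) ∧ z = F ω h₁ h₂}} ∧
      |sSup {y : ℝ | ∃ h₁ : Fin m → NNReal, (∀ k, 0 < h₁ k) ∧
        y = sInf {z : ℝ | ∃ h₂ : Fin m → NNReal, (∀ k, 0 < h₂ k) ∧ z = F ω h₁ h₂}}| ≤ B * u := by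
    intro ω u hu hq1 hq2
    have hAu : A ≤ A * u := le_mul_of_one_le_right hA0 hu
    have hu0 : 0 < u := by linarith
    have c1 : 0 ≤ σ * (K1 * u) := by positivity
    have c2 : 0 ≤ σ * (K2 * u) := by positivity
    have hBu : B * u = A * u + σ * (K1 * u) + σ * (K2 * u) := by rw [hB]; ring
    have hA1 : ∑ k, a k * (((1 : Fin m → NNReal) k : NNReal) : ℝ) ^ α k = A := by simp [hA]
    refine aux_W (fun h : Fin m → NNReal => ∀ k, 0 < h k) (F ω) (B * u) (by positivity) 1
      (by simp) ?_ ?_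
    · intro x hx
      have := hup ω x 1 (K2 * u) (by simp) (not_lt.1 fun hlt => hq2
        ⟨x, 1, fun k => zero_le, fun k => le_refl _, hlt⟩)
      rw [hA1] at this
      linarith
    · intro y hy
      have := hlow ω 1 y (K1 * u) (by simp) (not_lt.1 fun hlt => hq1
        ⟨1, y, fun k => le_refl _, fun k => zero_le, hlt⟩)
      rw [hA1] at this
      linarith
  have hQ : ∀ u : ℝ, 1 ≤ u → P {ω | Q1 u ω ∨ Q2 u ω} ≤ ENNReal.ofReal (8 * Real.exp (-u ^ 2)) := by
    intro u hu
    calc P {ω | Q1 u ω ∨ Q2 u ω} ≤ P {ω | Q1 u ω} + P {ω | Q2 u ω} := measure_union_le _ _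
      _ ≤ ENNReal.ofReal (4 * Real.exp (-u ^ 2)) + ENNReal.ofReal (4 * Real.exp (-u ^ 2)) :=
        add_le_add (hT1 u hu) (hT2 u hu)
      _ = _ := by
        rw [← ENNReal.ofReal_add (by positivity) (by positivity)]
        congr 1
        ring
  refine ⟨?_, 4 * B ^ 2, by positivity, ?_⟩
  · have hn : ∀ n : ℕ, ∀ᵐ ω ∂P, ∃ c : ℝ, ∀ h₁ h₂ : Fin m → NNReal,
        (∀ k, (1 / ((n : NNReal) + 1)) ≤ h₁ k) →
        |𝔾 (h₁, h₂) ω / ∏ k : Fin m, ((h₁ k : ℝ) + (h₂ k : ℝ))| ≤ c := by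
      intro n
      obtain ⟨K, hK, hT⟩ := aux_sup m P 𝔾 hGauss hcov hcont (1 / ((n : NNReal) + 1)) 0
        (by positivity)
      filter_upwards [aux_ae P _ hT] with ω hω
      obtain ⟨u, hu, hnot⟩ := hω
      exact ⟨K * u, fun h₁ h₂ hh => not_lt.1 fun hlt =>
        hnot ⟨h₁, h₂, hh, fun k => zero_le, hlt⟩⟩
    filter_upwards [ae_all_iff.2 hn, aux_ae P _ hT1, aux_ae P _ hT2] with ω hω h1 h2
    obtain ⟨u1, hu1, hn1⟩ := h1
    obtain ⟨u2, hu2, hn2⟩ := h2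
    have hm1 : u1 ≤ max u1 u2 := le_max_left _ _
    have hm2 : u2 ≤ max u1 u2 := le_max_right _ _
    refine ⟨(hdet ω (max u1 u2) (hu1.trans hm1) ?_ ?_).1, ?_⟩
    · rintro ⟨h₁, h₂, x, y, hlt⟩
      exact hn1 ⟨h₁, h₂, x, y, lt_of_le_of_lt (by gcongr) hlt⟩
    · rintro ⟨h₁, h₂, x, y, hlt⟩
      exact hn2 ⟨h₁, h₂, x, y, lt_of_le_of_lt (by gcongr) hlt⟩
    · intro h₁ hp
      have hex : ∃ n : ℕ, ∀ k, (1 / ((n : NNReal) + 1)) ≤ h₁ k := by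
        have : ∀ k, ∃ n : ℕ, (1 / ((n : NNReal) + 1)) < h₁ k := fun k =>
          exists_nat_one_div_lt (hp k)
        choose N hN using this
        refine ⟨Finset.univ.sup N, fun k => le_trans ?_ (hN k).le⟩
        have : N k ≤ Finset.univ.sup N := Finset.le_sup (Finset.mem_univ k)
        gcongr
      obtain ⟨n, hn'⟩ := hex
      obtain ⟨c, hc⟩ := hω n
      refine ⟨-(σ * c + ∑ k, a k * (h₁ k : ℝ) ^ α k), ?_⟩
      rintro z ⟨h₂, _, rfl⟩
      exact hlow ω h₁ h₂ c hp (hc h₁ h₂ hn')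
  · intro u hu
    set t : ℝ := u / B with ht
    have hut : u = B * t := by rw [ht]; field_simp
    have ht0 : 0 < t := by positivity
    have hexp : -u ^ 2 / (4 * B ^ 2) = -(t ^ 2 / 4) := by rw [hut]; field_simp
    rw [hexp]
    rcases le_total (t ^ 2) 2 with h | h
    · refine prob_le_one.trans ?_
      rw [← ENNReal.ofReal_one]
      apply ENNReal.ofReal_le_ofReal
      have := Real.add_one_le_exp (-(t ^ 2 / 4))
      linarith
    · have ht1 : 1 ≤ t := by nlinarith
      refine (measure_mono ?_).trans ((hQ t ht1).trans ?_)
      · intro ω hω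
        by_contra hcon
        have hcon' : ¬ Q1 t ω ∧ ¬ Q2 t ω := not_or.1 hcon
        have := (hdet ω t ht1 hcon'.1 hcon'.2).2
        rw [← hut] at this
        exact absurd hω (not_lt.2 this)
      · apply ENNReal.ofReal_le_ofReal
        have e : Real.exp (-(t ^ 2 / 4)) = Real.exp (-t ^ 2) * Real.exp (3 * t ^ 2 / 4) := by
          rw [← Real.exp_add]; congr 1; ring
        have h4 : 4 ≤ Real.exp (3 * t ^ 2 / 4) := by
          have a1 : Real.exp (3 / 2) ≤ Real.exp (3 * t ^ 2 / 4) := Real.exp_le_exp.2 (by linarith)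
          have a2 := Real.exp_one_gt_d9
          have a3 : Real.exp (3 / 2) = Real.exp 1 * Real.exp (1 / 2) := by
            rw [← Real.exp_add]; norm_num
          have a4 := Real.add_one_le_exp (1 / 2 : ℝ)
          nlinarith
        rw [e]
        nlinarith [Real.exp_pos (-t ^ 2)]
end
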